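/- arXiv:1207.2414 — 2 statements merged into one kernel-verified Lean document; each statement's English description precedes it below -/
import Mathlib

section
/- Assume W ∈ C² satisfies condition (a'') and W''(t) ≥ 0 for all t with μ − t > 0 sufficiently small. Fix ε ∈ (0, μ) and D > 0, and suppose that for each large R > 0, u_R is a classical solution of Δu = W'(u) in B_R with u = 0 on ∂B_R such that 0 < u_R < μ in B_R, u_R ≥ μ − ε on the closed ball of radius R − D, and the rescaled profiles u_R(R − s) converge together with their first derivatives, uniformly on compact subintervals of [0,∞), to 𝐔 as R → ∞. Then for all sufficiently large R, the solution u_R is linearly non-degenerate: any classical solution φ of −Δφ + W''(u_R)φ = 0 in B_R with φ = 0 on ∂B_R is identically zero. -/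
open Metric Set Filter Pointwise

noncomputable section

/-- The Laplacian of `u : ℝⁿ → ℝ`: the sum of the second partial derivatives. -/
def lap {n : ℕ} (u : EuclideanSpace ℝ (Fin n) → ℝ) (x : EuclideanSpace ℝ (Fin n)) : ℝ :=
  ∑ i : Fin n, fderiv ℝ (fun y => fderiv ℝ u y (EuclideanSpace.single i 1)) x
    (EuclideanSpace.single i 1)

/-- Condition (a'): `W` is `C²`, `μ > 0`, `W μ = 0`, `W > 0` on `[0, μ)`, `W ≥ 0` everywhere,
and either `W(-t) ≥ W(t)` on `[0, μ]` or `W' < 0` on `(-∞, 0)`. -/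
def CondA' (W : ℝ → ℝ) (μ : ℝ) : Prop :=
  ContDiff ℝ 2 W ∧ 0 < μ ∧ W μ = 0 ∧ (∀ t ∈ Set.Ico (0:ℝ) μ, 0 < W t) ∧
    (∀ t : ℝ, 0 ≤ W t) ∧
    ((∀ t ∈ Set.Icc (0:ℝ) μ, W t ≤ W (-t)) ∨ (∀ t < (0:ℝ), deriv W t < 0))

/-- `U` is the heteroclinic profile: `U'' = W'(U)` on `(0, ∞)`, `U 0 = 0`, `U → μ` at `∞`. -/
def IsHetero (W : ℝ → ℝ) (μ : ℝ) (U : ℝ → ℝ) : Prop :=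
  ContDiffOn ℝ 2 U (Set.Ici 0) ∧ U 0 = 0 ∧
    (∀ s > (0:ℝ), deriv (deriv U) s = deriv W (U s)) ∧
    Filter.Tendsto U Filter.atTop (nhds μ)

/-- `Ω` has boundary of class `C²`, via local `C²` defining functions. -/
def HasC2Boundary {n : ℕ} (Ω : Set (EuclideanSpace ℝ (Fin n))) : Prop :=
  ∀ x ∈ frontier Ω, ∃ (V : Set (EuclideanSpace ℝ (Fin n))) (f : EuclideanSpace ℝ (Fin n) → ℝ),
    IsOpen V ∧ x ∈ V ∧ ContDiffOn ℝ 2 f V ∧ (∀ y ∈ V, fderiv ℝ f y ≠ 0) ∧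
    Ω ∩ V = {y ∈ V | f y < 0} ∧ frontier Ω ∩ V = {y ∈ V | f y = 0}

/-- Condition (a''). -/
def CondA'' (W : ℝ → ℝ) (μm μ : ℝ) : Prop :=
  ContDiff ℝ 2 W ∧ μm ≤ 0 ∧ 0 < μ ∧ W μ = 0 ∧ (∀ t ∈ Set.Ico μm μ, 0 < W t) ∧
    (∀ t : ℝ, 0 ≤ W t) ∧
    ((∀ t ∈ Set.Icc μm μ, W t ≤ W (2*μm - t)) ∨ (∀ t < μm, deriv W t < 0))

/-- The radial profile of a function: its values along the first coordinate axis. -/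
def prof {n : ℕ} (hn : 0 < n) (v : EuclideanSpace ℝ (Fin n) → ℝ) (r : ℝ) : ℝ :=
  v (r • EuclideanSpace.single (⟨0, hn⟩ : Fin n) 1)


open scoped Topology

/-- Laplacian over an arbitrary orthonormal basis. -/
lemma lap_onb {n : ℕ} {f : EuclideanSpace ℝ (Fin n) → ℝ} {x : EuclideanSpace ℝ (Fin n)}
    (hf : ContDiffAt ℝ 2 f x) (v : OrthonormalBasis (Fin n) ℝ (EuclideanSpace ℝ (Fin n))) :
    lap f x = ∑ i, fderiv ℝ (fderiv ℝ f) x (v i) (v i) := by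
  have hd : DifferentiableAt ℝ (fderiv ℝ f) x :=
    (hf.fderiv_right (m := 1) (by norm_num)).differentiableAt (by norm_num)
  have h1 : lap f x = ∑ i, fderiv ℝ (fderiv ℝ f) x (EuclideanSpace.single i 1)
      (EuclideanSpace.single i 1) := by
    unfold lap
    refine Finset.sum_congr rfl fun i _ => ?_
    rw [fderiv_clm_apply hd (differentiableAt_const _)]
    simp
  have h2 := congrFun (InnerProductSpace.laplacian_eq_iteratedFDeriv_orthonormalBasis f v) x
  have h3 := congrFun (InnerProductSpace.laplacian_eq_iteratedFDeriv_orthonormalBasis f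
    (EuclideanSpace.basisFun (Fin n) ℝ)) x
  rw [h2] at h3
  simp only [iteratedFDeriv_two_apply] at h3
  rw [h1]
  simpa using h3.symm

lemma line_first {n : ℕ} {f : EuclideanSpace ℝ (Fin n) → ℝ} {x : EuclideanSpace ℝ (Fin n)}
    (hf : ContDiffAt ℝ 2 f x) (v : EuclideanSpace ℝ (Fin n)) :
    ∀ᶠ t in 𝓝 (0:ℝ), HasDerivAt (fun t : ℝ => f (x + t • v)) (fderiv ℝ f (x + t • v) v) t := by
  have h1 : ∀ᶠ y in 𝓝 x, ContDiffAt ℝ 2 f y := hf.eventually (by simp)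
  have hc : Tendsto (fun t : ℝ => x + t • v) (𝓝 0) (𝓝 x) := by
    have : ContinuousAt (fun t : ℝ => x + t • v) 0 := by fun_prop
    simpa [ContinuousAt] using this
  filter_upwards [hc.eventually h1] with t ht
  have hl : HasDerivAt (fun t : ℝ => x + t • v) v t := by
    simpa using ((hasDerivAt_id t).smul_const v).const_add x
  exact (ht.differentiableAt (by norm_num)).hasFDerivAt.comp_hasDerivAt t hl

lemma line_second {n : ℕ} {f : EuclideanSpace ℝ (Fin n) → ℝ} {x : EuclideanSpace ℝ (Fin n)}
    (hf : ContDiffAt ℝ 2 f x) (v : EuclideanSpace ℝ (Fin n)) :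
    HasDerivAt (fun t : ℝ => fderiv ℝ f (x + t • v) v) (fderiv ℝ (fderiv ℝ f) x v v) 0 := by
  have hd : DifferentiableAt ℝ (fderiv ℝ f) x :=
    (hf.fderiv_right (m := 1) (by norm_num)).differentiableAt (by norm_num)
  have hl : HasDerivAt (fun t : ℝ => x + t • v) v 0 := by
    simpa using ((hasDerivAt_id (0:ℝ)).smul_const v).const_add x
  have hd' : HasFDerivAt (fderiv ℝ f) (fderiv ℝ (fderiv ℝ f) x) (x + (0:ℝ) • v) := by
    simpa using hd.hasFDerivAt
  have := hd'.comp_hasDerivAt (0:ℝ) hl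
  simpa using this.clm_apply (hasDerivAt_const (0:ℝ) v)

/-- One-dimensional second order necessary condition. -/
lemma second_nonneg {k k1 : ℝ → ℝ} {k2 x : ℝ} (hm : IsLocalMin k x)
    (h1 : ∀ᶠ t in 𝓝 x, HasDerivAt k (k1 t) t) (h2 : HasDerivAt k1 k2 x) : 0 ≤ k2 := by
  by_contra hneg
  push Not at hneg
  have he : deriv k =ᶠ[𝓝 x] k1 := h1.mono fun t ht => ht.deriv
  have hdd : deriv (deriv k) x = k2 := by rw [he.deriv_eq, h2.deriv]
  have hmax : IsLocalMax k x := isLocalMax_of_deriv_deriv_neg (by rw [hdd]; exact hneg)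
    hm.deriv_eq_zero h1.self_of_nhds.continuousAt
  have hc : k =ᶠ[𝓝 x] fun _ => k x := by
    filter_upwards [hm, hmax] with t ht ht' using le_antisymm ht' ht
  have hc2 : deriv k =ᶠ[𝓝 x] fun _ => 0 := by
    have := hc.deriv
    simpa using this
  have : deriv (deriv k) x = 0 := by rw [hc2.deriv_eq]; simp
  linarith

/-- Touching principle: if `f - G(|x-c|²) - H(⟨e,x⟩)` has a local minimum at `x₀`. -/
lemma touch {n : ℕ} {f : EuclideanSpace ℝ (Fin n) → ℝ} {x c e : EuclideanSpace ℝ (Fin n)}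
    (hf : ContDiffAt ℝ 2 f x) {G G1 H H1 : ℝ → ℝ} {G2 H2 : ℝ}
    (hG : ∀ᶠ t in 𝓝 (‖x - c‖^2), HasDerivAt G (G1 t) t) (hG1 : HasDerivAt G1 G2 (‖x - c‖^2))
    (hH : ∀ᶠ t in 𝓝 (inner ℝ e x), HasDerivAt H (H1 t) t) (hH1 : HasDerivAt H1 H2 (inner ℝ e x))
    (hmin : IsLocalMin (fun y => f y - G (‖y - c‖^2) - H (inner ℝ e y)) x) :
    4 * ‖x - c‖^2 * G2 + 2 * n * G1 (‖x - c‖^2) + ‖e‖^2 * H2 ≤ lap f x := by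
  set v := EuclideanSpace.basisFun (Fin n) ℝ
  have key : ∀ i, 0 ≤ fderiv ℝ (fderiv ℝ f) x (v i) (v i)
      - (G2 * (2 * inner ℝ (x - c) (v i)) ^ 2 + 2 * G1 (‖x - c‖^2))
      - H2 * (inner ℝ e (v i))^2 := by
    intro i
    set b := inner ℝ (x - c) (v i)
    set a := inner ℝ e (v i)
    have hv : ‖v i‖ = 1 := v.norm_eq_one i
    have hq : ∀ t : ℝ, ‖x + t • v i - c‖^2 = ‖x - c‖^2 + 2 * b * t + t^2 := by
      intro t
      have : x + t • v i - c = (x - c) + t • v i := by abel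
      rw [this, norm_add_sq_real, inner_smul_right, norm_smul, hv]
      simp [b]; ring
    have hl : ∀ t : ℝ, inner ℝ e (x + t • v i) = inner ℝ e x + a * t := by
      intro t; rw [inner_add_right, inner_smul_right]; ring
    have hqd : ∀ t : ℝ, HasDerivAt (fun t : ℝ => ‖x - c‖^2 + 2 * b * t + t^2) (2*b + 2*t) t := by
      intro t
      have := (((hasDerivAt_id' t).const_mul (2*b)).const_add (‖x - c‖^2)).fun_add
        ((hasDerivAt_id' t).fun_pow 2)
      refine HasDerivAt.congr_deriv this ?_
      norm_num
    have hld : ∀ t : ℝ, HasDerivAt (fun t : ℝ => inner ℝ e x + a * t) a t := by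
      intro t
      simpa using ((hasDerivAt_id t).const_mul a).const_add (inner ℝ e x)
    have hqc : Tendsto (fun t : ℝ => ‖x - c‖^2 + 2 * b * t + t^2) (𝓝 0) (𝓝 (‖x - c‖^2)) := by
      have := (hqd 0).continuousAt
      simpa [ContinuousAt] using this
    have hlc : Tendsto (fun t : ℝ => inner ℝ e x + a * t) (𝓝 0) (𝓝 (inner ℝ e x)) := by
      have := (hld 0).continuousAt
      simpa [ContinuousAt] using this
    have hxc : Tendsto (fun t : ℝ => x + t • v i) (𝓝 0) (𝓝 x) := by
      have : ContinuousAt (fun t : ℝ => x + t • v i) 0 := by fun_prop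
      simpa [ContinuousAt] using this
    have hmin' : IsLocalMin (fun t : ℝ => f (x + t • v i) - G (‖x - c‖^2 + 2 * b * t + t^2)
        - H (inner ℝ e x + a * t)) 0 := by
      have := hxc.eventually hmin
      filter_upwards [this] with t ht
      simp only [hq, hl] at ht
      simpa using ht
    have hd1 : ∀ᶠ t in 𝓝 (0:ℝ), HasDerivAt (fun t : ℝ => f (x + t • v i)
        - G (‖x - c‖^2 + 2 * b * t + t^2) - H (inner ℝ e x + a * t))
        (fderiv ℝ f (x + t • v i) (v i) - G1 (‖x - c‖^2 + 2 * b * t + t^2) * (2*b+2*t)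
          - H1 (inner ℝ e x + a * t) * a) t := by
      filter_upwards [line_first hf (v i), hqc.eventually hG, hlc.eventually hH] with t h1 h2 h3
      exact (h1.sub (h2.comp t (hqd t))).sub (h3.comp t (hld t))
    have hd2 : HasDerivAt (fun t : ℝ => fderiv ℝ f (x + t • v i) (v i)
          - G1 (‖x - c‖^2 + 2 * b * t + t^2) * (2*b+2*t) - H1 (inner ℝ e x + a * t) * a)
        (fderiv ℝ (fderiv ℝ f) x (v i) (v i)
          - (G2 * (2 * b) ^ 2 + 2 * G1 (‖x - c‖^2)) - H2 * a^2) 0 := by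
      have e1 : HasDerivAt G1 G2 (‖x - c‖^2 + 2 * b * 0 + 0^2) := by simpa using hG1
      have e2 : HasDerivAt H1 H2 (inner ℝ e x + a * 0) := by simpa using hH1
      have e3 : HasDerivAt (fun t : ℝ => 2*b+2*t) 2 0 := by
        simpa using ((hasDerivAt_id (0:ℝ)).const_mul 2).const_add (2*b)
      have := ((line_second hf (v i)).sub ((e1.comp (0:ℝ) (hqd 0)).mul e3)).sub
        ((e2.comp (0:ℝ) (hld 0)).mul_const a)
      refine HasDerivAt.congr_deriv this ?_
      simp only [Function.comp_apply, mul_zero, add_zero, ne_eq, OfNat.ofNat_ne_zero,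
        not_false_eq_true, zero_pow]
      ring
    exact second_nonneg hmin' hd1 hd2
  have hsum := Finset.sum_nonneg fun i (_ : i ∈ Finset.univ) => key i
  have s1 : ∑ i, (inner ℝ (x - c) (v i))^2 = ‖x - c‖^2 := by
    have := v.sum_sq_norm_inner_left (x - c)
    simpa using this
  have s2 : ∑ i, (inner ℝ e (v i))^2 = ‖e‖^2 := by
    have := v.sum_sq_norm_inner_left e
    simpa using this
  rw [lap_onb hf v]
  simp only [Finset.sum_sub_distrib, Finset.sum_add_distrib, mul_pow, ← Finset.mul_sum, s1, s2,
    Finset.sum_const, Finset.card_univ, Fintype.card_fin, nsmul_eq_mul] at hsum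
  nlinarith [hsum]

lemma touch_max {n : ℕ} {f : EuclideanSpace ℝ (Fin n) → ℝ} {x c : EuclideanSpace ℝ (Fin n)}
    (hf : ContDiffAt ℝ 2 f x) {G G1 : ℝ → ℝ} {G2 : ℝ}
    (hG : ∀ᶠ t in 𝓝 (‖x - c‖^2), HasDerivAt G (G1 t) t) (hG1 : HasDerivAt G1 G2 (‖x - c‖^2))
    (hmin : IsLocalMax (fun y => f y - G (‖y - c‖^2)) x) :
    lap f x ≤ 4 * ‖x - c‖^2 * G2 + 2 * n * G1 (‖x - c‖^2) := by
  have hf' : ContDiffAt ℝ 2 (fun y => - f y) x := hf.neg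
  have hl : lap (fun y => - f y) x = - lap f x := by
    unfold lap
    rw [← Finset.sum_neg_distrib]
    refine Finset.sum_congr rfl fun i _ => ?_
    have : (fun y => fderiv ℝ (fun y => - f y) y (EuclideanSpace.single i 1))
      = fun y => - (fderiv ℝ f y (EuclideanSpace.single i 1)) := by
      ext y; simp [fderiv_fun_neg]
    rw [this, fderiv_fun_neg]; simp
  have := touch (n := n) (f := fun y => - f y) (x := x) (c := c) (e := 0) hf'
    (G := fun t => - G t) (G1 := fun t => - G1 t) (G2 := -G2) (H := fun _ => 0) (H1 := fun _ => 0)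
    (H2 := 0) (hG.mono fun t ht => ht.neg) hG1.neg
    (Filter.Eventually.of_forall fun t => hasDerivAt_const _ _) (hasDerivAt_const _ _)
    (by
      filter_upwards [hmin] with y hy
      linarith)
  rw [hl] at this
  simp at this
  linarith

/-- reflection across the hyperplane `⟨e,x⟩ = l`. -/
def reflP {n : ℕ} (e : EuclideanSpace ℝ (Fin n)) (l : ℝ) (x : EuclideanSpace ℝ (Fin n)) :
    EuclideanSpace ℝ (Fin n) := x + (2 * (l - inner ℝ e x)) • e

lemma refl_eq {n : ℕ} {e : EuclideanSpace ℝ (Fin n)} (he : ‖e‖ = 1) (l : ℝ)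
    (x : EuclideanSpace ℝ (Fin n)) :
    reflP e l x = (Submodule.reflection (Submodule.span ℝ {e})ᗮ) x + (2 * l) • e := by
  rw [Submodule.reflection_orthogonal_apply, Submodule.reflection_singleton_apply, reflP]
  simp [he]
  module

lemma lap_refl {n : ℕ} {f : EuclideanSpace ℝ (Fin n) → ℝ} {e : EuclideanSpace ℝ (Fin n)}
    (he : ‖e‖ = 1) (l : ℝ) {x : EuclideanSpace ℝ (Fin n)} (hf : ContDiffAt ℝ 2 f (reflP e l x)) :
    ContDiffAt ℝ 2 (fun y => f (reflP e l y)) x ∧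
    lap (fun y => f (reflP e l y)) x = lap f (reflP e l x) := by
  set A := (Submodule.reflection (Submodule.span ℝ {e})ᗮ)
  have hA : ∀ y, reflP e l y = A y + (2 * l) • e := refl_eq he l
  have hrd : ∀ y, HasFDerivAt (reflP e l) (A.toContinuousLinearEquiv :
      EuclideanSpace ℝ (Fin n) →L[ℝ] EuclideanSpace ℝ (Fin n)) y := by
    intro y
    have : reflP e l = fun y => A y + (2 * l) • e := funext hA
    rw [this]
    exact (A.toContinuousLinearEquiv.hasFDerivAt (x := y)).add_const _
  have hrs : ContDiff ℝ 2 (reflP e l) := by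
    have : reflP e l = fun y => A y + (2 * l) • e := funext hA
    rw [this]
    exact A.contDiff.add contDiff_const
  have hc : ContDiffAt ℝ 2 (fun y => f (reflP e l y)) x := hf.comp x hrs.contDiffAt
  refine ⟨hc, ?_⟩
  set v := EuclideanSpace.basisFun (Fin n) ℝ
  rw [lap_onb hc v, lap_onb hf (v.map A)]
  refine Finset.sum_congr rfl fun i _ => ?_
  have hd : DifferentiableAt ℝ (fderiv ℝ f) (reflP e l x) :=
    (hf.fderiv_right (m := 1) (by norm_num)).differentiableAt (by norm_num)
  have hev : fderiv ℝ (fun y => f (reflP e l y)) =ᶠ[𝓝 x] fun y => (fderiv ℝ f (reflP e l y)).comp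
      (A.toContinuousLinearEquiv :
      EuclideanSpace ℝ (Fin n) →L[ℝ] EuclideanSpace ℝ (Fin n)) := by
    have h1 : ∀ᶠ y in 𝓝 (reflP e l x), ContDiffAt ℝ 2 f y := hf.eventually (by simp)
    filter_upwards [(hrd x).continuousAt.eventually h1] with y hy
    exact ((hy.differentiableAt (by norm_num)).hasFDerivAt.comp y (hrd y)).fderiv
  rw [hev.fderiv_eq]
  have h2 := (hd.hasFDerivAt.comp x (hrd x)).clm_comp (hasFDerivAt_const
    (A.toContinuousLinearEquiv :
      EuclideanSpace ℝ (Fin n) →L[ℝ] EuclideanSpace ℝ (Fin n)) x)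
  have h3 := h2.fderiv
  simp only [Function.comp_def] at h3
  rw [h3]
  simp


lemma lap_laplacian {n : ℕ} {f : EuclideanSpace ℝ (Fin n) → ℝ} {x : EuclideanSpace ℝ (Fin n)}
    (hf : ContDiffAt ℝ 2 f x) : lap f x = Laplacian.laplacian f x := by
  rw [lap_onb hf (EuclideanSpace.basisFun (Fin n) ℝ),
    InnerProductSpace.laplacian_eq_iteratedFDeriv_orthonormalBasis f
      (EuclideanSpace.basisFun (Fin n) ℝ)]
  simp [iteratedFDeriv_two_apply]

lemma lap_sub' {n : ℕ} {f g : EuclideanSpace ℝ (Fin n) → ℝ} {x : EuclideanSpace ℝ (Fin n)}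
    (hf : ContDiffAt ℝ 2 f x) (hg : ContDiffAt ℝ 2 g x) :
    lap (fun y => f y - g y) x = lap f x - lap g x := by
  rw [lap_laplacian hf, lap_laplacian hg, lap_laplacian (hf.sub hg)]
  exact hf.laplacian_sub hg

lemma ball_pos_arith5 {η Q q X N j L w lp : ℝ} (hle : 4 * X * (η * (-((j+1+1) * (-((j+1) * Q))))) +
      2 * N * (η * (-((j+1+1) * (Q * q)))) ≤ lp) (h : lp ≤ L * w) (hLw : L * w ≤ L * (η * (Q * q^2))) :
    η * Q * (4 * X * ((j+2)*(j+1)) - 2 * N * (j+2) * q - L * q^2) ≤ 0 := by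
  have e : η * Q * (4 * X * ((j+2)*(j+1)) - 2 * N * (j+2) * q - L * q^2) =
    (4 * X * (η * (-((j+1+1) * (-((j+1) * Q))))) +
      2 * N * (η * (-((j+1+1) * (Q * q))))) - L * (η * (Q * q^2)) := by ring
  rw [e]; linarith

lemma ball_pos_arith6 {X ρ r q N j L : ℝ} (hρ2 : ρ^2 ≤ X) (hρ0 : 0 < ρ) (hj0 : 0 ≤ j) (hn0 : 0 ≤ N)
    (hq0 : 0 < q) (hqr : q ≤ r^2) (hL : 0 ≤ L) (hj : 2 * N * r^2 + L * r^4 < j * (4 * ρ^2)) :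
    0 < 4 * X * ((j+2)*(j+1)) - 2 * N * (j+2) * q - L * q^2 := by
  have a1 : 4 * ρ^2 * ((j+2)*(j+1)) ≤ 4 * X * ((j+2)*(j+1)) := by gcongr
  have a2 : 2 * N * (j+2) * q ≤ 2 * N * (j+2) * r^2 := by gcongr
  have a3 : L * q^2 ≤ L * (r^2)^2 := by gcongr
  have h4 : 0 ≤ L * r^4 := by positivity
  have a4 : L * (r^2)^2 ≤ (j+2) * (L * r^4) := by
    have : L * (r^2)^2 = L * r^4 := by ring
    rw [this]
    have := mul_nonneg hj0 h4
    linarith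
  have a5 : (2 * N * r^2 + L * r^4) * (j+2) < (j * (4 * ρ^2) + 4*ρ^2) * (j+2) := by
    have : 0 < 4 * ρ^2 := by positivity
    apply mul_lt_mul_of_pos_right _ (by linarith)
    linarith
  have e1 : (2 * N * r^2 + L * r^4) * (j+2) = 2 * N * (j+2) * r^2 + (j+2) * (L * r^4) := by ring
  have e2 : (j * (4 * ρ^2) + 4*ρ^2) * (j+2) = 4 * ρ^2 * ((j+2)*(j+1)) := by ring
  linarith

lemma ball_pos {n : ℕ} {w : EuclideanSpace ℝ (Fin n) → ℝ} {x₀ : EuclideanSpace ℝ (Fin n)}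
    {r L : ℝ} (hL : 0 ≤ L)
    (hc : ∀ y ∈ ball x₀ r, ContDiffAt ℝ 2 w y) (h0 : ∀ y ∈ ball x₀ r, 0 ≤ w y)
    (hl : ∀ y ∈ ball x₀ r, lap w y ≤ L * w y) (hx : 0 < w x₀) :
    ∀ z ∈ ball x₀ r, 0 < w z := by
  intro z hz
  rw [mem_ball, dist_eq_norm] at hz
  obtain ⟨r', hzr, hr'⟩ := exists_between hz
  have hr'0 : 0 < r' := lt_of_le_of_lt (norm_nonneg _) hzr
  have hsub : closedBall x₀ r' ⊆ ball x₀ r := closedBall_subset_ball hr'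
  have hcont : ContinuousOn w (closedBall x₀ r') :=
    fun y hy => (hc y (hsub hy)).continuousAt.continuousWithinAt
  have hx0 : ContinuousAt w x₀ := (hc x₀ (hsub (mem_closedBall_self hr'0.le))).continuousAt
  obtain ⟨ρ', hρ'0, hρ'⟩ := Metric.eventually_nhds_iff_ball.1
    (hx0.eventually (lt_mem_nhds (half_lt_self hx)))
  set ρ := ρ' / 2 with hρ
  have hρ0 : 0 < ρ := by positivity
  set m := w x₀ / 2
  have hm0 : 0 < m := by positivity
  have hm : ∀ y, ‖y - x₀‖ ≤ ρ → m < w y := by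
    intro y hy
    apply hρ'
    rw [mem_ball, dist_eq_norm]; linarith
  obtain ⟨j, hj⟩ := exists_nat_gt ((2 * n * r'^2 + L * r'^4) / (4 * ρ^2))
  rw [div_lt_iff₀ (by positivity)] at hj
  set k := j + 2
  set η := m / (r'^2)^k with hη
  have hη0 : 0 < η := by positivity
  by_contra hwz
  push Not at hwz
  have hcf : ContinuousOn (fun y => w y - η * (r'^2 - ‖y - x₀‖^2)^k) (closedBall x₀ r') := by
    apply hcont.sub
    fun_prop
  obtain ⟨x₁, hx₁, hmin⟩ := (isCompact_closedBall x₀ r').exists_isMinOn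
    ⟨x₀, mem_closedBall_self hr'0.le⟩ hcf
  have hzmem : z ∈ closedBall x₀ r' := by
    rw [mem_closedBall, dist_eq_norm]; exact hzr.le
  have hneg : w x₁ - η * (r'^2 - ‖x₁ - x₀‖^2)^k < 0 := by
    have h1 : w x₁ - η * (r'^2 - ‖x₁ - x₀‖^2)^k ≤ w z - η * (r'^2 - ‖z - x₀‖^2)^k := hmin hzmem
    have h2 : 0 < r'^2 - ‖z - x₀‖^2 := by
      have := norm_nonneg (z - x₀)
      nlinarith
    have : 0 < η * (r'^2 - ‖z - x₀‖^2)^k := by positivity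
    linarith
  have hx₁n : ‖x₁ - x₀‖ ≤ r' := by rw [mem_closedBall, dist_eq_norm] at hx₁; exact hx₁
  have hw1 : 0 ≤ w x₁ := h0 _ (hsub hx₁)
  have hlt : ‖x₁ - x₀‖ < r' := by
    rcases hx₁n.lt_or_eq with h | h
    · exact h
    · rw [h] at hneg
      simp [k] at hneg
      linarith
  have hgt : ρ < ‖x₁ - x₀‖ := by
    by_contra hle
    push Not at hle
    have h1 := hm x₁ hle
    have h2 : (r'^2 - ‖x₁ - x₀‖^2)^k ≤ (r'^2)^k := by
      apply pow_le_pow_left₀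
      · nlinarith [norm_nonneg (x₁ - x₀)]
      · nlinarith [norm_nonneg (x₁ - x₀)]
    have h3 : η * (r'^2 - ‖x₁ - x₀‖^2)^k ≤ m := by
      calc η * (r'^2 - ‖x₁ - x₀‖^2)^k ≤ η * (r'^2)^k := by gcongr
        _ = m := by rw [hη]; field_simp
    linarith
  have hloc : IsLocalMin (fun y => w y - η * (r'^2 - ‖y - x₀‖^2)^k) x₁ := by
    apply hmin.isLocalMin
    apply mem_of_superset (isOpen_ball.mem_nhds _) ball_subset_closedBall
    rw [mem_ball, dist_eq_norm]; exact hlt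
  have hpow : ∀ (i : ℕ) (t : ℝ), HasDerivAt (fun t : ℝ => (r'^2 - t)^(i+1))
      (-((i+1) * (r'^2 - t)^i)) t := by
    intro i t
    have := ((hasDerivAt_id' t).const_sub (r'^2)).fun_pow (i+1)
    refine HasDerivAt.congr_deriv this ?_
    push_cast
    simp
  have ht := touch (n := n) (f := w) (x := x₁) (c := x₀) (e := 0) (hc x₁ (hsub hx₁))
    (G := fun t => η * (r'^2 - t)^k) (G1 := fun t => η * (-((j+1+1) * (r'^2 - t)^(j+1))))
    (G2 := η * (-((j+1+1) * (-((j+1) * (r'^2 - ‖x₁ - x₀‖^2)^j)))))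
    (H := fun _ => 0) (H1 := fun _ => 0) (H2 := 0)
    (Filter.Eventually.of_forall fun t => by
      have := (hpow (j+1) t).const_mul η
      push_cast at this
      exact this)
    (((hpow j _).const_mul _).neg.const_mul η)
    (Filter.Eventually.of_forall fun t => hasDerivAt_const _ _) (hasDerivAt_const _ _)
    (by simpa using hloc)
  have hle := ht.trans (hl x₁ (hsub hx₁))
  set q := r'^2 - ‖x₁ - x₀‖^2 with hq
  have hq0 : 0 < q := by nlinarith [norm_nonneg (x₁ - x₀)]
  have hqr : q ≤ r'^2 := by nlinarith [norm_nonneg (x₁ - x₀)]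
  have hLw : L * w x₁ ≤ L * (η * q^(j+2)) := mul_le_mul_of_nonneg_left (by linarith) hL
  have h5 : η * q^j * (4 * ‖x₁ - x₀‖^2 * ((j+2)*(j+1)) - 2 * n * (j+2) * q - L * q^2) ≤ 0 := by
    have e1 : q^(j+2) = q^j * q^2 := pow_add _ _ _
    have e2 : q^(j+1) = q^j * q := pow_succ _ _
    rw [e1] at hLw
    rw [e2, mul_zero, add_zero] at hle
    exact ball_pos_arith5 hle le_rfl hLw
  have h6 : 0 < 4 * ‖x₁ - x₀‖^2 * ((j+2)*(j+1)) - 2 * n * (j+2) * q - L * q^2 :=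
    ball_pos_arith6 (pow_le_pow_left₀ hρ0.le hgt.le 2) hρ0 (Nat.cast_nonneg j) (Nat.cast_nonneg n)
      hq0 hqr hL hj
  have h7 : 0 < η * q^j := by positivity
  exact absurd (mul_pos h7 h6) (not_lt.2 h5)

lemma strong_max {n : ℕ} {w : EuclideanSpace ℝ (Fin n) → ℝ} {Ω : Set (EuclideanSpace ℝ (Fin n))}
    {L : ℝ} (hL : 0 ≤ L) (ho : IsOpen Ω) (hcv : Convex ℝ Ω)
    (hc : ∀ y ∈ Ω, ContDiffAt ℝ 2 w y) (h0 : ∀ y ∈ Ω, 0 ≤ w y)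
    (hl : ∀ y ∈ Ω, lap w y ≤ L * w y) {a b : EuclideanSpace ℝ (Fin n)} (ha : a ∈ Ω) (hb : b ∈ Ω)
    (hx : 0 < w a) : 0 < w b := by
  have hcomp : IsCompact (segment ℝ a b) := by
    rw [segment_eq_image_lineMap]
    exact isCompact_Icc.image AffineMap.lineMap_continuous
  obtain ⟨r, hr0, hr⟩ := hcomp.exists_thickening_subset_open ho (hcv.segment_subset ha hb)
  obtain ⟨N, hN⟩ := exists_nat_gt (‖b - a‖ / r)
  have hN0 : (0:ℝ) < N := lt_of_le_of_lt (by positivity) hN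
  rw [div_lt_iff₀ hr0] at hN
  have hmem : ∀ i : ℕ, i ≤ N → AffineMap.lineMap a b ((i:ℝ)/N) ∈ segment ℝ a b := by
    intro i hi
    rw [segment_eq_image_lineMap]
    refine ⟨_, ⟨by positivity, ?_⟩, rfl⟩
    rw [div_le_one hN0]; exact_mod_cast hi
  have key : ∀ i : ℕ, i ≤ N → 0 < w (AffineMap.lineMap a b ((i:ℝ)/N)) := by
    intro i
    induction i with
    | zero => intro _; simpa using hx
    | succ i ih =>
      intro hi
      have hi' : i ≤ N := by omega
      have hsub : ball (AffineMap.lineMap a b ((i:ℝ)/N)) r ⊆ Ω := by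
        intro y hy
        exact hr (mem_thickening_iff.2 ⟨_, hmem i hi', hy⟩)
      refine ball_pos hL (fun y hy => hc y (hsub hy)) (fun y hy => h0 y (hsub hy))
        (fun y hy => hl y (hsub hy)) (ih hi') _ ?_
      rw [mem_ball, dist_lineMap_lineMap, dist_eq_norm a b, norm_sub_rev a b, Real.dist_eq]
      push_cast
      have : ((i:ℝ)+1)/N - i/N = 1/N := by field_simp; ring
      rw [this, abs_of_pos (by positivity)]
      rw [one_div, inv_mul_lt_iff₀ hN0]
      exact hN
  have := key N le_rfl
  rw [div_self hN0.ne'] at this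
  simpa using this

structure IsSol {n : ℕ} (R μ L : ℝ) (F : ℝ → ℝ) (u : EuclideanSpace ℝ (Fin n) → ℝ) : Prop where
  n0 : 0 < n
  R0 : 0 < R
  L0 : 0 ≤ L
  cont : ContinuousOn u (closedBall 0 R)
  smooth : ∀ x, ‖x‖ < R → ContDiffAt ℝ 2 u x
  eq : ∀ x, ‖x‖ < R → lap u x = F (u x)
  bd : ∀ x, ‖x‖ = R → u x = 0
  rng : ∀ x, ‖x‖ < R → 0 < u x ∧ u x < μ
  lip : ∀ a ∈ Icc 0 μ, ∀ b ∈ Icc 0 μ, |F a - F b| ≤ L * |a - b|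

lemma norm_reflP {n : ℕ} {e : EuclideanSpace ℝ (Fin n)} (he : ‖e‖ = 1) (l : ℝ)
    (x : EuclideanSpace ℝ (Fin n)) :
    ‖reflP e l x‖^2 = ‖x‖^2 + 4 * l * (l - inner ℝ e x) := by
  rw [reflP, norm_add_sq_real, inner_smul_right, norm_smul, he, real_inner_comm, mul_one,
    Real.norm_eq_abs, sq_abs]
  ring

lemma norm_reflP_le {n : ℕ} {e : EuclideanSpace ℝ (Fin n)} (he : ‖e‖ = 1) {l : ℝ}
    {x : EuclideanSpace ℝ (Fin n)} (hl : 0 ≤ l) (hx : l ≤ inner ℝ e x) :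
    ‖reflP e l x‖ ≤ ‖x‖ := by
  apply le_of_sq_le_sq _ (norm_nonneg _)
  rw [norm_reflP he]
  have := mul_nonneg hl (sub_nonneg.2 hx)
  linarith

lemma norm_reflP_lt {n : ℕ} {e : EuclideanSpace ℝ (Fin n)} (he : ‖e‖ = 1) {l : ℝ}
    {x : EuclideanSpace ℝ (Fin n)} (hl : 0 < l) (hx : l < inner ℝ e x) :
    ‖reflP e l x‖ < ‖x‖ := by
  apply lt_of_pow_lt_pow_left₀ 2 (norm_nonneg _)
  rw [norm_reflP he]
  have := mul_pos hl (sub_pos.2 hx)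
  linarith

lemma continuous_reflP {n : ℕ} (e : EuclideanSpace ℝ (Fin n)) (l : ℝ) :
    Continuous (reflP e l) := by
  unfold reflP; fun_prop

lemma inner_le_norm_of {n : ℕ} {e : EuclideanSpace ℝ (Fin n)} (he : ‖e‖ = 1)
    (x : EuclideanSpace ℝ (Fin n)) : inner ℝ e x ≤ ‖x‖ := by
  have := real_inner_le_norm e x
  rwa [he, one_mul] at this

lemma isOpen_cap {n : ℕ} (e : EuclideanSpace ℝ (Fin n)) (l R : ℝ) :
    IsOpen {x : EuclideanSpace ℝ (Fin n) | ‖x‖ < R ∧ l < inner ℝ e x} := by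
  have h1 : IsOpen {x : EuclideanSpace ℝ (Fin n) | ‖x‖ < R} :=
    isOpen_lt (by fun_prop) (by fun_prop)
  have h2 : IsOpen {x : EuclideanSpace ℝ (Fin n) | l < inner ℝ e x} :=
    isOpen_lt (by fun_prop) (by fun_prop)
  exact h1.inter h2

namespace IsSol
variable {n : ℕ} {R μ L : ℝ} {F : ℝ → ℝ} {u : EuclideanSpace ℝ (Fin n) → ℝ}

lemma nonneg (h : IsSol R μ L F u) {x : EuclideanSpace ℝ (Fin n)} (hx : ‖x‖ ≤ R) : 0 ≤ u x := by
  rcases hx.lt_or_eq with h1 | h1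
  · exact (h.rng x h1).1.le
  · exact (h.bd x h1).ge

lemma lapw (h : IsSol R μ L F u) {e : EuclideanSpace ℝ (Fin n)} (he : ‖e‖ = 1) {l : ℝ}
    {x : EuclideanSpace ℝ (Fin n)} (hx : ‖x‖ < R) (hr : ‖reflP e l x‖ < R) :
    ContDiffAt ℝ 2 (fun y => u (reflP e l y) - u y) x ∧
    lap (fun y => u (reflP e l y) - u y) x ≤ L * |u (reflP e l x) - u x| := by
  obtain ⟨h1, h2⟩ := lap_refl he l (h.smooth _ hr)
  refine ⟨h1.sub (h.smooth x hx), ?_⟩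
  rw [lap_sub' h1 (h.smooth x hx), h2, h.eq _ hr, h.eq _ hx]
  refine (le_abs_self _).trans (h.lip _ ?_ _ ?_)
  · exact ⟨(h.rng _ hr).1.le, (h.rng _ hr).2.le⟩
  · exact ⟨(h.rng _ hx).1.le, (h.rng _ hx).2.le⟩

lemma contw (h : IsSol R μ L F u) {e : EuclideanSpace ℝ (Fin n)} (he : ‖e‖ = 1) {l : ℝ}
    (hl : 0 ≤ l) :
    ContinuousOn (fun y => u (reflP e l y) - u y) {x | ‖x‖ ≤ R ∧ l ≤ inner ℝ e x} := by
  apply ContinuousOn.sub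
  · apply h.cont.comp (continuous_reflP e l).continuousOn
    intro x hx
    rw [mem_closedBall_zero_iff]
    exact (norm_reflP_le he hl hx.2).trans hx.1
  · apply h.cont.mono
    intro x hx
    rw [mem_closedBall_zero_iff]
    exact hx.1

lemma narrow (h : IsSol R μ L F u) {e : EuclideanSpace ℝ (Fin n)} (he : ‖e‖ = 1) {l M : ℝ}
    (hl : 0 ≤ l) (hM : 2 ≤ M) (hML : 2 * L < M * Real.exp (-1))
    (hw : ∀ x : EuclideanSpace ℝ (Fin n), ‖x‖ < R → l + 1/M ≤ inner ℝ e x → 1/M ≤ R^2 - ‖x‖^2 →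
      u x ≤ u (reflP e l x)) :
    ∀ x : EuclideanSpace ℝ (Fin n), ‖x‖ ≤ R → l ≤ inner ℝ e x → u x ≤ u (reflP e l x) := by
  intro x₀ hx₀ hx₀l
  by_contra hcon
  push Not at hcon
  have hM0 : 0 < M := by linarith
  set K : Set (EuclideanSpace ℝ (Fin n)) := {x | ‖x‖ ≤ R ∧ l ≤ inner ℝ e x} with hK
  have hKc : IsCompact K := by
    have : K = closedBall 0 R ∩ {x | l ≤ inner ℝ e x} := by
      ext x; simp [hK]
    rw [this]
    exact (isCompact_closedBall 0 R).inter_right (isClosed_le (by fun_prop) (by fun_prop))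
  set w := fun y => u (reflP e l y) - u y with hwdef
  set E1 := fun y : EuclideanSpace ℝ (Fin n) => Real.exp (-(M * (R^2 - ‖y‖^2))) with hE1
  set E2 := fun y : EuclideanSpace ℝ (Fin n) => Real.exp (-(M * (inner ℝ e y - l))) with hE2
  set g := fun y => 2 - E2 y / 2 - E1 y / 2 with hg
  have hE1le : ∀ y ∈ K, E1 y ≤ 1 := by
    intro y hy
    rw [hE1, Real.exp_le_one_iff, neg_nonpos]
    apply mul_nonneg hM0.le
    have := pow_le_pow_left₀ (norm_nonneg y) hy.1 2
    linarith
  have hE2le : ∀ y ∈ K, E2 y ≤ 1 := by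
    intro y hy
    rw [hE2, Real.exp_le_one_iff, neg_nonpos]
    exact mul_nonneg hM0.le (sub_nonneg.2 hy.2)
  have hE1p : ∀ y, 0 < E1 y := fun y => Real.exp_pos _
  have hE2p : ∀ y, 0 < E2 y := fun y => Real.exp_pos _
  have hg1 : ∀ y ∈ K, 1 ≤ g y := by
    intro y hy
    have := hE1le y hy; have := hE2le y hy
    simp only [hg]; linarith
  have hg2 : ∀ y, g y ≤ 2 := by
    intro y
    have := hE1p y; have := hE2p y
    simp only [hg]; linarith
  have hgc : Continuous g := by
    simp only [hg, hE1, hE2]; fun_prop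
  obtain ⟨x₁, hx₁, hmin⟩ := hKc.exists_isMinOn ⟨x₀, hx₀, hx₀l⟩
    ((h.contw he hl).div hgc.continuousOn (fun y hy => by have := hg1 y hy; linarith))
  have hgx1 : 0 < g x₁ := by have := hg1 x₁ hx₁; linarith
  set τ := -(w x₁ / g x₁) with hτ
  have hτ0 : 0 < τ := by
    have h1 : w x₁ / g x₁ ≤ w x₀ / g x₀ := hmin ⟨hx₀, hx₀l⟩
    have h2 : w x₀ / g x₀ < 0 := by
      apply div_neg_of_neg_of_pos
      · simp only [hwdef]; linarith
      · have := hg1 x₀ ⟨hx₀, hx₀l⟩; linarith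
    linarith
  have hwx1 : w x₁ = -(τ * g x₁) := by rw [hτ]; field_simp
  have hwneg : w x₁ < 0 := by rw [hwx1]; have := mul_pos hτ0 hgx1; linarith
  have hge : ∀ y ∈ K, 0 ≤ w y + τ * g y := by
    intro y hy
    have h1 : w x₁ / g x₁ ≤ w y / g y := hmin hy
    have hgy : 0 < g y := by have := hg1 y hy; linarith
    have h2 : -τ ≤ w y / g y := by rw [hτ, neg_neg]; exact h1
    rw [le_div_iff₀ hgy] at h2
    linarith
  have hin : l < inner ℝ e x₁ := by
    rcases hx₁.2.lt_or_eq with h1 | h1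
    · exact h1
    · exfalso
      have : reflP e l x₁ = x₁ := by simp [reflP, ← h1]
      simp [hwdef, this] at hwneg
  have hnr : ‖reflP e l x₁‖ ≤ ‖x₁‖ := norm_reflP_le he hl hx₁.2
  have hxR : ‖x₁‖ < R := by
    rcases hx₁.1.lt_or_eq with h1 | h1
    · exact h1
    · exfalso
      have h2 := h.bd x₁ h1
      have h3 := h.nonneg (hnr.trans hx₁.1)
      simp only [hwdef] at hwneg
      linarith
  have hKn : K ∈ 𝓝 x₁ := by
    have ho : IsOpen {x : EuclideanSpace ℝ (Fin n) | ‖x‖ < R ∧ l < inner ℝ e x} :=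
      isOpen_cap e l R
    exact mem_of_superset (ho.mem_nhds ⟨hxR, hin⟩) fun y hy => ⟨hy.1.le, hy.2.le⟩
  have hthin : Real.exp (-1) ≤ E1 x₁ ∨ Real.exp (-1) ≤ E2 x₁ := by
    by_contra hno
    push Not at hno
    obtain ⟨h1, h2⟩ := hno
    rw [hE1, Real.exp_lt_exp] at h1
    rw [hE2, Real.exp_lt_exp] at h2
    have h3 := hw x₁ hxR (by
      have : 1 / M ≤ inner ℝ e x₁ - l := by rw [div_le_iff₀ hM0]; linarith
      linarith) (by rw [div_le_iff₀ hM0]; linarith)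
    simp only [hwdef] at hwneg
    linarith
  obtain ⟨hcw, hlw⟩ := h.lapw he hxR (lt_of_le_of_lt hnr hxR)
  have hexp1 : ∀ t : ℝ, HasDerivAt (fun t : ℝ => Real.exp (-(M * (R^2 - t))))
      (M * Real.exp (-(M * (R^2 - t)))) t := by
    intro t
    have := (((hasDerivAt_id' t).const_sub (R^2)).const_mul M).fun_neg.exp
    refine this.congr_deriv ?_
    ring
  have hexp2 : ∀ t : ℝ, HasDerivAt (fun t : ℝ => Real.exp (-(M * (t - l))))
      (-(M * Real.exp (-(M * (t - l))))) t := by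
    intro t
    have := (((hasDerivAt_id' t).sub_const l).const_mul M).fun_neg.exp
    refine this.congr_deriv ?_
    ring
  have ht := touch (n := n) (f := w) (x := x₁) (c := 0) (e := e) hcw
    (G := fun t => τ * (Real.exp (-(M * (R^2 - t))) / 2 - 2))
    (G1 := fun t => τ * (M * Real.exp (-(M * (R^2 - t))) / 2))
    (G2 := τ * (M * (M * Real.exp (-(M * (R^2 - ‖x₁ - 0‖^2)))) / 2))
    (H := fun t => τ * (Real.exp (-(M * (t - l))) / 2))
    (H1 := fun t => τ * (-(M * Real.exp (-(M * (t - l)))) / 2))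
    (H2 := τ * (-(M * (-(M * Real.exp (-(M * (inner ℝ e x₁ - l)))))) / 2))
    (Filter.Eventually.of_forall fun t => (((hexp1 t).div_const 2).sub_const 2).const_mul τ)
    ((((hexp1 _).const_mul M).div_const 2).const_mul τ)
    (Filter.Eventually.of_forall fun t => ((hexp2 t).div_const 2).const_mul τ)
    ((((hexp2 _).const_mul M).neg.div_const 2).const_mul τ)
    (by
      have key : ∀ y : EuclideanSpace ℝ (Fin n), w y - τ * (Real.exp (-(M * (R^2 - ‖y - 0‖^2))) / 2 - 2) -
          τ * (Real.exp (-(M * (inner ℝ e y - l))) / 2) = w y + τ * g y := by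
        intro y
        simp only [hg, hE1, hE2, sub_zero]; ring
      filter_upwards [hKn] with y hy
      rw [key, key]
      have := hge y hy
      rw [hwx1]; linarith)
  rw [sub_zero, he] at ht
  have ht' := ht.trans hlw
  change _ ≤ L * |w x₁| at ht'
  rw [abs_of_neg hwneg, hwx1, neg_neg] at ht'
  have hE1x : Real.exp (-(M * (R^2 - ‖x₁‖^2))) = E1 x₁ := rfl
  have hE2x : Real.exp (-(M * (inner ℝ e x₁ - l))) = E2 x₁ := rfl
  rw [hE1x, hE2x] at ht'
  have hn1 : (1:ℝ) ≤ n := by exact_mod_cast h.n0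
  have p1 : 0 ≤ 4 * ‖x₁‖ ^ 2 * (τ * (M * (M * E1 x₁) / 2)) := by
    have := hE1p x₁; positivity
  have p2 : τ * (M * E1 x₁) ≤ 2 * n * (τ * (M * E1 x₁ / 2)) := by
    have : 0 ≤ τ * (M * E1 x₁) := by have := hE1p x₁; positivity
    have := mul_le_mul_of_nonneg_right hn1 this
    linarith
  have p3 : τ * (M * E2 x₁) ≤ 1^2 * (τ * (-(M * -(M * E2 x₁)) / 2)) := by
    have : 0 ≤ τ * (M * E2 x₁) := by have := hE2p x₁; positivity
    have := mul_le_mul_of_nonneg_right hM this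
    linarith
  have p4 : L * (τ * g x₁) ≤ τ * (2 * L) := by
    have := mul_le_mul_of_nonneg_left (hg2 x₁) (mul_nonneg h.L0 hτ0.le)
    linarith
  have p5 : τ * (2 * L) < τ * (M * Real.exp (-1)) := mul_lt_mul_of_pos_left hML hτ0
  have p6 : 0 ≤ τ * (M * E1 x₁) := by have := hE1p x₁; positivity
  have p7 : 0 ≤ τ * (M * E2 x₁) := by have := hE2p x₁; positivity
  rcases hthin with h1 | h1
  · have : τ * (M * Real.exp (-1)) ≤ τ * (M * E1 x₁) := by gcongr
    linarith
  · have : τ * (M * Real.exp (-1)) ≤ τ * (M * E2 x₁) := by gcongr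
    linarith

lemma strict (h : IsSol R μ L F u) {e : EuclideanSpace ℝ (Fin n)} (he : ‖e‖ = 1) {l : ℝ}
    (hl : 0 < l)
    (hP : ∀ x : EuclideanSpace ℝ (Fin n), ‖x‖ ≤ R → l ≤ inner ℝ e x → u x ≤ u (reflP e l x))
    {x : EuclideanSpace ℝ (Fin n)} (hx : ‖x‖ < R) (hxl : l < inner ℝ e x) :
    0 < u (reflP e l x) - u x := by
  have hlR : l < R := hxl.trans_le ((inner_le_norm_of he x).trans hx.le)
  set Ω : Set (EuclideanSpace ℝ (Fin n)) := {x | ‖x‖ < R ∧ l < inner ℝ e x} with hΩ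
  have ho : IsOpen Ω :=
      isOpen_cap e l R
  have hcv : Convex ℝ Ω := by
    have : Ω = ball 0 R ∩ {x | l < inner ℝ e x} := by ext x; simp [hΩ]
    rw [this]
    apply (convex_ball _ _).inter
    exact convex_halfSpace_gt (IsLinearMap.mk (fun x y => inner_add_right _ _ _)
      (fun c x => by rw [inner_smul_right]; rfl)) l
  have hinn : ∀ s : ℝ, inner ℝ e (s • e) = s := by
    intro s; rw [inner_smul_right, real_inner_self_eq_norm_sq, he]; ring
  have hrf : ∀ s : ℝ, reflP e l (s • e) = (2 * l - s) • e := by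
    intro s; rw [reflP, hinn]; module
  have hnm : ∀ s : ℝ, ‖s • e‖ = |s| := by intro s; rw [norm_smul, he]; simp
  obtain ⟨s, hs, hsl, hsR⟩ : ∃ s, 0 < u (reflP e l (s • e)) - u (s • e) ∧ l < s ∧ s < R := by
    have hc : ContinuousOn (fun s : ℝ => u (reflP e l (s • e)) - u (s • e)) (Icc l R) := by
      apply (h.contw he hl.le).comp (f := fun s : ℝ => s • e) (by fun_prop)
      intro s hs
      simp only [mem_ofPred_eq]
      rw [hnm, hinn, abs_of_nonneg (hl.le.trans hs.1)]
      exact ⟨hs.2, hs.1⟩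
    have h1 : 0 < u (reflP e l (R • e)) - u (R • e) := by
      have h2 : u (R • e) = 0 := h.bd _ (by rw [hnm, abs_of_pos h.R0])
      rw [h2, hrf, sub_zero]
      apply (h.rng _ _).1
      rw [hnm, abs_lt]; constructor <;> linarith
    have h2 := (hc R ⟨hlR.le, le_rfl⟩).eventually (lt_mem_nhds h1)
    have h3 : ∀ᶠ s in 𝓝[<] R, 0 < u (reflP e l (s • e)) - u (s • e) := by
      have : 𝓝[Ioo l R] R ≤ 𝓝[Icc l R] R := nhdsWithin_mono _ Ioo_subset_Icc_self
      rw [nhdsWithin_Ioo_eq_nhdsLT hlR] at this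
      exact this h2
    have h4 : ∀ᶠ s in 𝓝[<] R, s ∈ Ioo l R := Ioo_mem_nhdsLT hlR
    obtain ⟨s, hs1, hs2⟩ := (h3.and h4).exists
    exact ⟨s, hs1, hs2.1, hs2.2⟩
  have hlw : ∀ y ∈ Ω, ContDiffAt ℝ 2 (fun y => u (reflP e l y) - u y) y ∧
    lap (fun y => u (reflP e l y) - u y) y ≤ L * |u (reflP e l y) - u y| := fun y hy =>
    h.lapw he hy.1 ((norm_reflP_le he hl.le hy.2.le).trans_lt hy.1)
  have hnn : ∀ y ∈ Ω, 0 ≤ u (reflP e l y) - u y := fun y hy =>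
    sub_nonneg.2 (hP y hy.1.le hy.2.le)
  refine strong_max (w := fun y => u (reflP e l y) - u y) h.L0 ho hcv (fun y hy => (hlw y hy).1)
    hnn (fun y hy => ?_) (a := s • e) (b := x) ?_ ⟨hx, hxl⟩ hs
  · have := (hlw y hy).2
    rwa [abs_of_nonneg (hnn y hy)] at this
  · refine ⟨?_, ?_⟩
    · rw [hnm, abs_of_pos (hl.trans hsl)]; exact hsR
    · rw [hinn]; exact hsl

lemma open_step (h : IsSol R μ L F u) {e : EuclideanSpace ℝ (Fin n)} (he : ‖e‖ = 1) {l₀ : ℝ}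
    (hl : 0 < l₀)
    (hP : ∀ x : EuclideanSpace ℝ (Fin n), ‖x‖ ≤ R → l₀ ≤ inner ℝ e x → u x ≤ u (reflP e l₀ x)) :
    ∃ η > 0, ∀ l, 0 ≤ l → l₀ - η < l → l < l₀ →
    ∀ x : EuclideanSpace ℝ (Fin n), ‖x‖ ≤ R → l ≤ inner ℝ e x → u x ≤ u (reflP e l x) := by
  set M := 2 + 2 * L * Real.exp 1 with hM
  have hM2 : 2 ≤ M := by
    have := h.L0
    have : 0 ≤ 2 * L * Real.exp 1 := by positivity
    linarith
  have hM0 : 0 < M := by linarith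
  have hML : 2 * L < M * Real.exp (-1) := by
    have e1 : Real.exp 1 * Real.exp (-1) = 1 := by rw [← Real.exp_add]; simp
    have : M * Real.exp (-1) = 2 * Real.exp (-1) + 2 * L * (Real.exp 1 * Real.exp (-1)) := by
      rw [hM]; ring
    rw [this, e1]
    have := Real.exp_pos (-1)
    linarith
  set K : Set (EuclideanSpace ℝ (Fin n)) :=
    {x | ‖x‖ ≤ R ∧ l₀ + 1/(2*M) ≤ inner ℝ e x ∧ 1/M ≤ R^2 - ‖x‖^2} with hK
  have hMi : 0 < 1 / M := by positivity
  have hMi2 : 1 / (2 * M) = (1 / M) / 2 := by field_simp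
  have hKc : IsCompact K := by
    have : K = closedBall 0 R ∩ ({x | l₀ + 1/(2*M) ≤ inner ℝ e x} ∩ {x | 1/M ≤ R^2 - ‖x‖^2}) := by
      ext x; simp [hK]
    rw [this]
    exact (isCompact_closedBall 0 R).inter_right
      ((isClosed_le (by fun_prop) (by fun_prop)).inter (isClosed_le (by fun_prop) (by fun_prop)))
  have hpos : ∀ x ∈ K, 0 < u (reflP e l₀ x) - u x := by
    intro x hx
    apply h.strict he hl hP
    · have h1 := hx.2.2
      apply lt_of_pow_lt_pow_left₀ 2 h.R0.le
      linarith
    · have := hx.2.1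
      rw [hMi2] at this; linarith
  obtain ⟨m, hm0, hm⟩ : ∃ m > 0, ∀ x ∈ K, m ≤ u (reflP e l₀ x) - u x := by
    rcases K.eq_empty_or_nonempty with h1 | h1
    · exact ⟨1, one_pos, by simp [h1]⟩
    · obtain ⟨x₁, hx₁, hmin⟩ := hKc.exists_isMinOn h1 ((h.contw he hl.le).mono (fun x hx => by
        refine ⟨hx.1, ?_⟩
        have := hx.2.1
        rw [hMi2] at this; linarith))
      exact ⟨_, hpos _ hx₁, fun x hx => hmin hx⟩
  have huc := (isCompact_closedBall (0 : EuclideanSpace ℝ (Fin n)) R).uniformContinuousOn_of_continuous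
    h.cont
  rw [Metric.uniformContinuousOn_iff] at huc
  obtain ⟨δ, hδ0, hδ⟩ := huc m hm0
  refine ⟨min (δ/2) (1/(2*M)), by positivity, ?_⟩
  intro l hl0 hl1 hl2
  have hη1 : l₀ - l < δ / 2 := by
    have := min_le_left (δ/2) (1/(2*M)); linarith
  have hη2 : l₀ - l < 1 / (2*M) := by
    have := min_le_right (δ/2) (1/(2*M)); linarith
  apply h.narrow he hl0 hM2 hML
  intro x hx hxl hxR
  have hxK : x ∈ K := by
    refine ⟨hx.le, ?_, hxR⟩
    rw [hMi2] at hη2 ⊢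
    linarith
  have h1 := hm x hxK
  have hxl0 : l₀ ≤ inner ℝ e x := by
    have := hxK.2.1
    rw [hMi2] at this; linarith
  have h2 := hδ (reflP e l x) (by
    rw [mem_closedBall_zero_iff]
    exact (norm_reflP_le he hl0 (hl2.le.trans hxl0)).trans hx.le) (reflP e l₀ x) (by
    rw [mem_closedBall_zero_iff]
    exact (norm_reflP_le he hl.le hxl0).trans hx.le) (by
    rw [dist_eq_norm]
    have : reflP e l x - reflP e l₀ x = (2 * (l - l₀)) • e := by
      simp only [reflP]; module
    rw [this, norm_smul, he, Real.norm_eq_abs, abs_of_neg (by linarith)]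
    linarith)
  rw [Real.dist_eq, abs_lt] at h2
  linarith [h2.1]

lemma planes (h : IsSol R μ L F u) {e : EuclideanSpace ℝ (Fin n)} (he : ‖e‖ = 1) {l : ℝ}
    (hl : 0 ≤ l) (hlR : l ≤ R) (x : EuclideanSpace ℝ (Fin n)) (hx : ‖x‖ ≤ R)
    (hxl : l ≤ inner ℝ e x) : u x ≤ u (reflP e l x) := by
  set S : Set ℝ := {t | ∀ x : EuclideanSpace ℝ (Fin n), ‖x‖ ≤ R → R - t ≤ inner ℝ e x →
    u x ≤ u (reflP e (R - t) x)} with hS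
  have hcl : IsClosed (S ∩ Icc 0 R) := by
    apply isClosed_of_closure_subset
    intro t ht
    obtain ⟨q, hq, hqt⟩ := mem_closure_iff_seq_limit.1 ht
    have htI : t ∈ Icc 0 R := isClosed_Icc.mem_of_tendsto hqt
      (Filter.Eventually.of_forall fun k => (hq k).2)
    refine ⟨?_, htI⟩
    intro x hx hxl
    rcases hxl.lt_or_eq with h1 | h1
    · have h2 : ∀ᶠ k in atTop, R - q k < inner ℝ e x :=
        (tendsto_const_nhds.sub hqt).eventually (gt_mem_nhds h1)
      have h3 : Tendsto (fun k => reflP e (R - q k) x) atTop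
          (𝓝[closedBall 0 R] (reflP e (R - t) x)) := by
        apply tendsto_nhdsWithin_of_tendsto_nhds_of_eventually_within
        · have : Continuous fun t => reflP e (R - t) x := by unfold reflP; fun_prop
          exact (this.tendsto t).comp hqt
        · filter_upwards [h2] with k hk
          rw [mem_closedBall_zero_iff]
          exact (norm_reflP_le he (sub_nonneg.2 (hq k).2.2) hk.le).trans hx
      have h4 := (h.cont (reflP e (R - t) x) (by
        rw [mem_closedBall_zero_iff]
        exact (norm_reflP_le he (sub_nonneg.2 htI.2) h1.le).trans hx)).tendsto.comp h3
      apply ge_of_tendsto h4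
      filter_upwards [h2] with k hk
      exact (hq k).1 x hx hk.le
    · have : reflP e (R - t) x = x := by simp [reflP, ← h1]
      rw [this]
  have h0 : (0:ℝ) ∈ S := by
    intro x hx hxl
    have h1 := inner_le_norm_of he x
    have : reflP e (R - 0) x = x := by
      have : inner ℝ e x = R := by linarith
      simp [reflP, this]
    rw [this]
  have hsub : Icc 0 R ⊆ S := by
    apply hcl.Icc_subset_of_forall_mem_nhdsWithin h0
    rintro t ⟨htS, ht0, htR⟩
    obtain ⟨η, hη, hη'⟩ := h.open_step he (l₀ := R - t) (by linarith) htS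
    have h1 : ∀ᶠ s in 𝓝[>] t, s ∈ Ioo t (min (t + η) R) :=
      Ioo_mem_nhdsGT (lt_min (by linarith) htR)
    filter_upwards [h1] with s hs
    have h2 := hs.2.trans_le (min_le_left _ _)
    have h3 := hs.2.trans_le (min_le_right _ _)
    exact hη' (R - s) (by linarith) (by linarith) (by linarith [hs.1])
  have := hsub (show R - l ∈ Icc 0 R from ⟨by linarith, by linarith⟩) x hx (by linarith)
  rwa [sub_sub_cancel] at this

lemma mono (h : IsSol R μ L F u) {x y : EuclideanSpace ℝ (Fin n)} (hxy : ‖x‖ ≤ ‖y‖)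
    (hy : ‖y‖ ≤ R) : u y ≤ u x := by
  by_cases hne : y = x
  · rw [hne]
  have hd : 0 < ‖y - x‖ := norm_pos_iff.2 (sub_ne_zero.2 hne)
  set d := ‖y - x‖ with hdd
  set e := d⁻¹ • (y - x) with he'
  have he : ‖e‖ = 1 := by
    rw [he', norm_smul, norm_inv, Real.norm_of_nonneg hd.le, ← hdd]
    exact inv_mul_cancel₀ hd.ne'
  have hd2 : d^2 = ‖y‖^2 - 2 * inner ℝ y x + ‖x‖^2 := norm_sub_sq_real y x
  have hin : inner ℝ e y = (‖y‖^2 - inner ℝ y x) / d := by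
    rw [he', real_inner_smul_left, inner_sub_left, real_inner_self_eq_norm_sq, real_inner_comm]
    field_simp
  set l := (‖y‖^2 - ‖x‖^2) / (2 * d) with hl
  have hl0 : 0 ≤ l := by
    apply div_nonneg _ (by positivity)
    have := pow_le_pow_left₀ (norm_nonneg x) hxy 2
    linarith
  have hli : l - inner ℝ e y = - d / 2 := by
    rw [hin, hl]
    field_simp
    linarith
  have hrf : reflP e l y = x := by
    rw [reflP, hli, he', smul_smul]
    have : 2 * (-d/2) * d⁻¹ = -1 := by field_simp
    rw [this]; module
  have h1 := inner_le_norm_of he y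
  have := h.planes he hl0 (by linarith) y hy (by linarith)
  rwa [hrf] at this

end IsSol

lemma lipW {W : ℝ → ℝ} (hW : ContDiff ℝ 2 W) (a b : ℝ) :
    ∃ L, 0 ≤ L ∧ ∀ s ∈ Icc a b, ∀ t ∈ Icc a b, |deriv W s - deriv W t| ≤ L * |s - t| := by
  have h1 : ContDiff ℝ 1 (deriv W) := by
    have h : ContDiff ℝ (1 + 1) W := by rw [one_add_one_eq_two]; exact hW
    exact h.deriv'
  have h2 : Continuous (deriv (deriv W)) := h1.continuous_deriv (by norm_num)
  obtain ⟨C, hC⟩ := (isCompact_Icc (a := a) (b := b)).exists_bound_of_continuousOn h2.continuousOn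
  refine ⟨max C 0, le_max_right _ _, ?_⟩
  intro s hs t ht
  have := (convex_Icc a b).norm_image_sub_le_of_norm_deriv_le (f := deriv W) (C := max C 0)
    (fun x _ => h1.differentiable (by norm_num) x)
    (fun x hx => (hC x hx).trans (le_max_left _ _)) ht hs
  simpa [Real.norm_eq_abs] using this

lemma quadW {W : ℝ → ℝ} (hW : ContDiff ℝ 2 W) {a b p L : ℝ} (hp : p ∈ Icc a b) (hWp : W p = 0)
    (hWp' : deriv W p = 0) (hL0 : 0 ≤ L)
    (hL : ∀ s ∈ Icc a b, ∀ t ∈ Icc a b, |deriv W s - deriv W t| ≤ L * |s - t|) {t : ℝ}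
    (ht : t ∈ Icc a b) : W t ≤ L * (t - p)^2 := by
  have hsub : uIcc p t ⊆ Icc a b := by
    rw [← uIcc_of_le (hp.1.trans hp.2)]
    apply uIcc_subset_uIcc <;> rw [uIcc_of_le (hp.1.trans hp.2)] <;> assumption
  have := (convex_uIcc p t).norm_image_sub_le_of_norm_deriv_le (f := W) (C := L * |t - p|)
    (fun x _ => hW.differentiable (by norm_num) x)
    (fun x hx => by
      have h1 := hL x (hsub hx) p hp
      rw [hWp', sub_zero] at h1
      refine h1.trans (mul_le_mul_of_nonneg_left ?_ hL0)
      exact abs_sub_left_of_mem_uIcc hx) left_mem_uIcc right_mem_uIcc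
  rw [hWp, sub_zero, Real.norm_eq_abs, Real.norm_eq_abs, mul_assoc, abs_mul_abs_self] at this
  have h2 := le_abs_self (W t)
  nlinarith

lemma hetero_y {W : ℝ → ℝ} {μ : ℝ} {U : ℝ → ℝ} (hU : IsHetero W μ U) :
    ∃ y : ℝ → ℝ, Continuous y ∧ (∀ s > 0, HasDerivAt U (y s) s) ∧
      (∀ s > 0, HasDerivAt y (deriv W (U s)) s) := by
  obtain ⟨hc, -, hode, -⟩ := hU
  have hy : ContDiffOn ℝ 1 (derivWithin U (Ici 0)) (Ici 0) :=
    hc.derivWithin (uniqueDiffOn_Ici 0) (by norm_num)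
  have hev : ∀ s > (0:ℝ), deriv U s = derivWithin U (Ici 0) s := by
    intro s hs
    exact (derivWithin_of_mem_nhds (Ici_mem_nhds hs)).symm
  refine ⟨fun s => derivWithin U (Ici 0) (max s 0), ?_, ?_, ?_⟩
  · exact hy.continuousOn.comp_continuous (by fun_prop) (fun s => le_max_right s 0)
  · intro s hs
    simp only [max_eq_left (le_of_lt hs)]
    rw [← hev s hs]
    exact ((hc.contDiffAt (Ici_mem_nhds hs)).differentiableAt (by norm_num)).hasDerivAt
  · intro s hs
    have h1 : (fun s => derivWithin U (Ici 0) (max s 0)) =ᶠ[𝓝 s] derivWithin U (Ici 0) := by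
      filter_upwards [Ioi_mem_nhds hs] with t ht
      rw [max_eq_left (le_of_lt ht)]
    have h2 : derivWithin U (Ici 0) =ᶠ[𝓝 s] deriv U := by
      filter_upwards [Ioi_mem_nhds hs] with t ht
      exact (hev t ht).symm
    have h3 := ((hy.contDiffAt (Ici_mem_nhds hs)).differentiableAt (by norm_num)).hasDerivAt
    rw [h2.deriv_eq, hode s hs] at h3
    exact h3.congr_of_eventuallyEq h1

lemma hetero_pos {W : ℝ → ℝ} {μ : ℝ} {U : ℝ → ℝ} (hW : ContDiff ℝ 2 W) (hW0 : 0 < W 0)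
    (hWn : ∀ t, 0 ≤ W t) (hμ : 0 < μ) (hWμ : W μ = 0) (hU : IsHetero W μ U) {y : ℝ → ℝ}
    (hy : Continuous y) (hUy : ∀ s > 0, HasDerivAt U (y s) s)
    (hyy : ∀ s > 0, HasDerivAt y (deriv W (U s)) s) : ∀ s ≥ 0, 0 < y s := by
  have hUc : ContinuousOn U (Ici 0) := hU.1.continuousOn
  have hU0 : U 0 = 0 := hU.2.1
  have hlim : Tendsto U atTop (𝓝 μ) := hU.2.2.2
  have hWd : ∀ t, HasDerivAt W (deriv W t) t :=
    fun t => (hW.differentiable (by norm_num) t).hasDerivAt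
  set c := (y 0)^2 / 2 - W 0 with hc
  have hE : ∀ s ≥ 0, (y s)^2 / 2 - W (U s) = c := by
    intro s hs
    rcases hs.lt_or_eq with h | h
    · obtain ⟨ξ, hξ, h1⟩ := exists_hasDerivAt_eq_slope (fun s => (y s)^2 / 2 - W (U s))
        (fun _ => 0) h (by
          apply ContinuousOn.sub (by fun_prop)
          exact hW.continuous.comp_continuousOn (hUc.mono Icc_subset_Ici_self))
        (fun x hx => by
          have := (((hyy x hx.1).fun_pow 2).div_const 2).fun_sub ((hWd (U x)).comp x (hUy x hx.1))
          refine this.congr_deriv ?_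
          norm_num; ring)
      have h2 : s - 0 ≠ 0 := by linarith
      rw [eq_div_iff h2] at h1
      simp only [hU0] at h1
      linarith
    · rw [← h, hU0]
  have hc0 : 0 ≤ c := by
    have h1 : Tendsto (fun s => c + W (U s)) atTop (𝓝 (c + W μ)) :=
      ((hW.continuous.tendsto μ).comp hlim).const_add c
    rw [hWμ, add_zero] at h1
    apply ge_of_tendsto h1
    filter_upwards [eventually_ge_atTop 0] with s hs
    have := hE s hs
    nlinarith [sq_nonneg (y s)]
  have hne : ∀ s ≥ 0, y s ≠ 0 := by
    intro s hs hys
    have h1 := hE s hs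
    rw [hys] at h1
    have hWs : W (U s) = 0 := by
      have := hWn (U s); norm_num at h1; linarith
    have hcz : c = 0 := by rw [hWs] at h1; norm_num at h1; linarith
    have hWs' : deriv W (U s) = 0 := by
      apply IsLocalMin.deriv_eq_zero
      exact Filter.Eventually.of_forall fun t => by rw [hWs]; exact hWn t
    obtain ⟨B, hB⟩ := (isCompact_Icc (a := 0) (b := s)).exists_bound_of_continuousOn
      (hUc.mono Icc_subset_Ici_self)
    have hmem : ∀ t ∈ Icc 0 s, U t ∈ Icc (-B) B := fun t ht => abs_le.1 (hB t ht)
    obtain ⟨L, hL0, hL⟩ := lipW hW (-B) B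
    have hq : ∀ t ∈ Icc 0 s, (y t)^2 ≤ 2 * L * (U t - U s)^2 := by
      intro t ht
      have h2 := quadW hW (hmem s ⟨hs, le_rfl⟩) hWs hWs' hL0 hL (hmem t ht)
      have h3 := hE t ht.1
      rw [hcz] at h3
      linarith
    have hmono : MonotoneOn (fun t => (U t - U s)^2 * Real.exp ((1 + 2 * L) * t)) (Icc 0 s) := by
      have hd : ∀ t ∈ Ioo 0 s, HasDerivAt (fun t => (U t - U s)^2 * Real.exp ((1 + 2 * L) * t))
          ((2 * (U t - U s) * y t + (1 + 2 * L) * (U t - U s)^2) * Real.exp ((1 + 2 * L) * t)) t := by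
        intro t ht
        have := (((hUy t ht.1).sub_const (U s)).fun_pow 2).fun_mul
          (((hasDerivAt_id' t).const_mul (1 + 2 * L)).exp)
        refine this.congr_deriv ?_
        norm_num; ring
      apply monotoneOn_of_deriv_nonneg (convex_Icc 0 s)
      · have := hUc.mono (show Icc 0 s ⊆ Ici 0 from Icc_subset_Ici_self)
        fun_prop
      · rw [interior_Icc]
        exact fun t ht => (hd t ht).differentiableAt.differentiableWithinAt
      · rw [interior_Icc]
        intro t ht
        rw [(hd t ht).deriv]
        apply mul_nonneg _ (Real.exp_pos _).le
        have := hq t ⟨ht.1.le, ht.2.le⟩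
        nlinarith [sq_nonneg (U t - U s + y t)]
    have h4 := hmono (left_mem_Icc.2 hs) (right_mem_Icc.2 hs) hs
    simp [hU0] at h4
    rw [h4] at hWs
    linarith
  intro s hs
  by_contra hys
  have hys' : y s < 0 := lt_of_le_of_ne (not_lt.1 hys) (hne s hs)
  have hneg : ∀ t ≥ 0, y t < 0 := by
    intro t ht
    by_contra h
    obtain ⟨z, hz, hz0⟩ := isPreconnected_Ici.intermediate_value (a := s) (b := t) hs ht
      hy.continuousOn ⟨hys'.le, not_lt.1 h⟩
    exact hne z hz hz0
  have hUneg : ∀ t > 0, U t ≤ 0 := by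
    intro t ht
    obtain ⟨ξ, hξ, h1⟩ := exists_hasDerivAt_eq_slope U y ht (hUc.mono Icc_subset_Ici_self)
      (fun x hx => hUy x hx.1)
    have h2 := hneg ξ hξ.1.le
    rw [h1, hU0, sub_zero, sub_zero] at h2
    rcases div_neg_iff.1 h2 with h3 | h3 <;> linarith
  have : μ ≤ 0 := le_of_tendsto hlim (by
    filter_upwards [eventually_gt_atTop 0] with t ht using hUneg t ht)
  linarith

lemma barrier {W : ℝ → ℝ} {μ : ℝ} {U : ℝ → ℝ} (hW : ContDiff ℝ 2 W) (hW0 : 0 < W 0)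
    (hWn : ∀ t, 0 ≤ W t) (hμ : 0 < μ) (hWμ : W μ = 0) (hU : IsHetero W μ U) {d : ℝ} (hd : 0 < d) :
    ∃ (s₁ κ C : ℝ) (ψ ψ1 ψ2 : ℝ → ℝ), 0 < s₁ ∧ 0 < κ ∧ 0 ≤ C ∧ ContinuousOn ψ (Icc 0 s₁) ∧
      (∀ s ∈ Icc 0 s₁, 0 < ψ s) ∧ (∀ s > 0, HasDerivAt ψ (ψ1 s) s) ∧
      (∀ s > 0, HasDerivAt ψ1 (ψ2 s) s) ∧
      (∀ s ∈ Ioc 0 s₁, ψ2 s ≤ deriv (deriv W) (U s) * ψ s - κ) ∧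
      (∀ s ∈ Ioc 0 s₁, |ψ1 s| ≤ C) ∧ 0 < ψ1 s₁ ∧ μ - d < U s₁ ∧
      (∀ s ∈ Icc 0 s₁, U s ∈ Icc 0 μ) := by
  obtain ⟨y, hy, hUy, hyy⟩ := hetero_y hU
  have hpos := hetero_pos hW hW0 hWn hμ hWμ hU hy hUy hyy
  have hUc : ContinuousOn U (Ici 0) := hU.1.continuousOn
  have hU0 : U 0 = 0 := hU.2.1
  have hlim : Tendsto U atTop (𝓝 μ) := hU.2.2.2
  have hW1 : ContDiff ℝ 1 (deriv W) := by
    have h : ContDiff ℝ (1 + 1) W := by rw [one_add_one_eq_two]; exact hW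
    exact h.deriv'
  have hWd : ∀ t, HasDerivAt (deriv W) (deriv (deriv W) t) t :=
    fun t => (hW1.differentiable (by norm_num) t).hasDerivAt
  have hUm : MonotoneOn U (Ici 0) := by
    apply monotoneOn_of_deriv_nonneg (convex_Ici 0) hUc
    · rw [interior_Ici]
      exact fun t ht => (hUy t ht).differentiableAt.differentiableWithinAt
    · rw [interior_Ici]
      intro t ht
      rw [(hUy t ht).deriv]
      exact (hpos t (le_of_lt ht)).le
  have hUr : ∀ s ≥ 0, U s ∈ Icc 0 μ := by
    intro s hs
    refine ⟨?_, ?_⟩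
    · rw [← hU0]; exact hUm self_mem_Ici hs hs
    · apply ge_of_tendsto hlim
      filter_upwards [eventually_ge_atTop s] with t ht
      exact hUm hs (hs.trans ht) ht
  -- positive continuous extension
  set z : ℝ → ℝ := fun s => y (max s 0) with hz
  have hzc : Continuous z := hy.comp (by fun_prop)
  have hzp : ∀ s, 0 < z s := fun s => hpos _ (le_max_right s 0)
  have hzy : ∀ s ≥ 0, z s = y s := by
    intro s hs; simp only [hz, max_eq_left hs]
  have hzne : ∀ s, z s ≠ 0 := fun s => (hzp s).ne'
  set q : ℝ → ℝ := fun t => 1 / (z t)^2 with hq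
  have hqc : Continuous q := by
    simp only [hq]
    exact continuous_const.div (hzc.pow 2) (fun s => pow_ne_zero 2 (hzne s))
  have hqp : ∀ s, 0 < q s := fun s => by have := hzp s; simp only [hq]; positivity
  set V : ℝ → ℝ := fun s => ∫ t in (0:ℝ)..s, q t with hV
  set T : ℝ → ℝ := fun s => ∫ t in (0:ℝ)..s, t * q t with hT
  have hVd : ∀ s, HasDerivAt V (q s) s := fun s => (hqc.integral_hasStrictDerivAt 0 s).hasDerivAt
  have hTd : ∀ s, HasDerivAt T (s * q s) s := fun s =>
    ((continuous_id.mul hqc).integral_hasStrictDerivAt 0 s).hasDerivAt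
  have hVp : ∀ s > 0, 0 < V s := by
    intro s hs
    exact intervalIntegral.intervalIntegral_pos_of_pos (hqc.intervalIntegrable _ _) hqp hs
  have hV0 : V 0 = 0 := by simp [hV]
  have hT0 : T 0 = 0 := by simp [hT]
  have hqy : ∀ s ≥ 0, q s = 1 / (y s)^2 := by intro s hs; simp only [hq, hzy s hs]
  obtain ⟨s₀, hs₀⟩ := (hlim.eventually (lt_mem_nhds (show μ - d < μ by linarith))).exists_forall_of_atTop
  obtain ⟨s₁, hs₁0, hs₁U, hA⟩ : ∃ s₁ > 0, μ - d < U s₁ ∧ 0 < deriv W (U s₁) * V s₁ + 1 / y s₁ := by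
    set a := max s₀ 1 with ha
    have ha0 : 0 < a := lt_of_lt_of_le one_pos (le_max_right _ _)
    by_contra hcon
    push Not at hcon
    have hcon' : ∀ s ≥ a, deriv W (U s) * V s + 1 / y s ≤ 0 := fun s hs =>
      hcon s (ha0.trans_le hs) (hs₀ s ((le_max_left _ _).trans hs))
    have hcp : 0 < y a * V a := mul_pos (hpos a ha0.le) (hVp a ha0)
    set Cc := y a * V a with hCc
    have hdyV : ∀ s > 0, HasDerivAt (fun s => y s * V s) (deriv W (U s) * V s + 1 / y s) s := by
      intro s hs
      refine ((hyy s hs).fun_mul (hVd s)).congr_deriv ?_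
      rw [hqy s hs.le]
      have := (hpos s hs.le).ne'
      field_simp
    have hVc : Continuous V := continuous_iff_continuousAt.2 fun s => (hVd s).continuousAt
    have hle : ∀ s ≥ a, y s * V s ≤ Cc := by
      intro s hs
      rcases hs.lt_or_eq with h | h
      · obtain ⟨ξ, hξ, h1⟩ := exists_hasDerivAt_eq_slope (fun s => y s * V s) _ h
          (by fun_prop) (fun x hx => hdyV x (ha0.trans hx.1))
        have h2 := hcon' ξ hξ.1.le
        rw [h1, div_nonpos_iff] at h2
        rcases h2 with h3 | h3 <;> linarith
      · rw [← h]
    have hWle : ∀ s ≥ a, deriv W (U s) ≤ - (1 / Cc) := by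
      intro s hs
      have h1 := hcon' s hs
      have hs0 : 0 < s := ha0.trans_le hs
      have hy0 := hpos s hs0.le
      have h2 : deriv W (U s) * (y s * V s) ≤ -1 := by
        have := mul_le_mul_of_nonneg_left h1 hy0.le
        have e : y s * (deriv W (U s) * V s + 1 / y s) = deriv W (U s) * (y s * V s) + 1 := by
          field_simp
        rw [e] at this; linarith
      have h3 := hle s hs
      have h4 : 0 < y s * V s := mul_pos hy0 (hVp s hs0)
      have h5 : deriv W (U s) < 0 := by
        by_contra h
        have := mul_nonneg (not_lt.1 h) h4.le
        linarith
      have h6 : deriv W (U s) * Cc ≤ -1 := by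
        have := mul_le_mul_of_nonpos_left h3 h5.le
        linarith
      have : deriv W (U s) ≤ -1 / Cc := by rw [le_div_iff₀ hcp]; exact h6
      rw [neg_div] at this; exact this
    have hb : a < a + Cc * y a := by
      have := mul_pos hcp (hpos a ha0.le); linarith
    obtain ⟨ξ, hξ, h1⟩ := exists_hasDerivAt_eq_slope y _ hb
          hy.continuousOn (fun x hx => hyy x (ha0.trans hx.1))
    have h2 := hWle ξ hξ.1.le
    rw [h1, add_sub_cancel_left, div_le_iff₀ (mul_pos hcp (hpos a ha0.le))] at h2
    have h3 : -(1 / Cc) * (Cc * y a) = - y a := by field_simp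
    have h4 := hpos (a + Cc * y a) (ha0.trans hb).le
    linarith
  set A := deriv W (U s₁) * V s₁ + 1 / y s₁ with hAdef
  set B := deriv W (U s₁) * (1 - T s₁) - s₁ / y s₁ with hB
  set κ := min (1 / s₁) (A / (2 * (|B| + 1))) with hκ
  have hκ0 : 0 < κ := by positivity
  have hκ1 : κ * s₁ ≤ 1 := by
    have := min_le_left (1 / s₁) (A / (2 * (|B| + 1)))
    rwa [le_div_iff₀ hs₁0] at this
  have hκ2 : 0 < A + κ * B := by
    have h1 : κ ≤ A / (2 * (|B| + 1)) := min_le_right _ _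
    rw [le_div_iff₀ (by positivity)] at h1
    have h2 : - |B| ≤ B := neg_abs_le B
    have h3 := mul_le_mul_of_nonneg_left h2 hκ0.le
    nlinarith
  set v : ℝ → ℝ := fun s => κ + V s - κ * T s with hv
  have hvd : ∀ s, HasDerivAt v ((1 - κ * s) * q s) s := by
    intro s
    refine (((hVd s).const_add κ).fun_sub ((hTd s).const_mul κ)).congr_deriv ?_
    ring
  have hvc : Continuous v := continuous_iff_continuousAt.2 fun s => (hvd s).continuousAt
  have hvp : ∀ s ∈ Icc 0 s₁, κ ≤ v s := by
    have hm : MonotoneOn v (Icc 0 s₁) := by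
      apply monotoneOn_of_deriv_nonneg (convex_Icc 0 s₁) hvc.continuousOn
      · exact fun t ht => (hvd t).differentiableAt.differentiableWithinAt
      · rw [interior_Icc]
        intro t ht
        rw [(hvd t).deriv]
        apply mul_nonneg _ (hqp t).le
        have := mul_le_mul_of_nonneg_left ht.2.le hκ0.le
        linarith
    intro s hs
    have := hm (left_mem_Icc.2 hs₁0.le) hs hs.1
    simpa [hv, hV0, hT0] using this
  obtain ⟨Y, hY⟩ := (isCompact_Icc (a := 0) (b := s₁)).exists_bound_of_continuousOn hy.continuousOn
  have hY0 : 0 < Y := by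
    have := hY 0 (left_mem_Icc.2 hs₁0.le)
    have h2 := hpos 0 le_rfl
    have := le_abs_self (y 0)
    rw [Real.norm_eq_abs] at *
    linarith
  set ψ1 : ℝ → ℝ := fun s => deriv W (U s) * v s + (1 - κ * s) / y s with hψ1
  have hψ1c : ContinuousOn ψ1 (Icc 0 s₁) := by
    have h1 : ContinuousOn (fun s => deriv W (U s)) (Icc 0 s₁) :=
      hW1.continuous.comp_continuousOn (hUc.mono Icc_subset_Ici_self)
    exact (h1.mul hvc.continuousOn).add (ContinuousOn.div (by fun_prop) hy.continuousOn
      (fun s hs => (hpos s hs.1).ne'))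
  obtain ⟨C, hC⟩ := (isCompact_Icc (a := 0) (b := s₁)).exists_bound_of_continuousOn hψ1c
  refine ⟨s₁, κ / Y, max C 0, fun s => y s * v s, ψ1,
    fun s => deriv (deriv W) (U s) * (y s * v s) - κ / y s, hs₁0, by positivity, le_max_right _ _,
    by fun_prop, ?_, ?_, ?_, ?_, ?_, ?_, hs₁U, fun s hs => hUr s hs.1⟩
  · intro s hs
    exact mul_pos (hpos s hs.1) (hκ0.trans_le (hvp s hs))
  · intro s hs
    refine ((hyy s hs).fun_mul (hvd s)).congr_deriv ?_
    rw [hqy s hs.le]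
    have := (hpos s hs.le).ne'
    simp only [hψ1]
    field_simp
  · intro s hs
    have h1 := ((hWd (U s)).comp s (hUy s hs)).fun_mul (hvd s)
    have h0 := (hpos s hs.le).ne'
    have h2 := (((hasDerivAt_id' s).const_mul κ).const_sub 1).fun_div (hyy s hs) h0
    refine (h1.fun_add h2).congr_deriv ?_
    rw [hqy s hs.le]
    simp only [Function.comp]
    field_simp
    ring
  · intro s hs
    have h1 := hpos s hs.1.le
    have h2 : y s ≤ Y := (le_abs_self _).trans (hY s ⟨hs.1.le, hs.2⟩)
    have h3 : κ / Y ≤ κ / y s := by gcongr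
    linarith
  · intro s hs
    exact (hC s ⟨hs.1.le, hs.2⟩).trans (le_max_left _ _)
  · have : ψ1 s₁ = A + κ * B := by
      simp only [hψ1, hv, hAdef, hB]; ring
    rw [this]; exact hκ2

lemma kink {ψ : ℝ → ℝ} {p s₁ : ℝ} (h : HasDerivAt ψ p s₁) (hp : 0 < p) :
    ∃ η > 0, ∀ s, s₁ - η < s → s ≤ s₁ → ψ s ≤ ψ s₁ - p / 2 * (s₁ - s) := by
  have h1 := h.isLittleO.def (half_pos hp)
  obtain ⟨η, hη, h2⟩ := Metric.eventually_nhds_iff_ball.1 h1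
  refine ⟨η, hη, fun s hs hs' => ?_⟩
  have h3 := h2 s (by rw [mem_ball, Real.dist_eq, abs_lt]; constructor <;> linarith)
  rw [Real.norm_eq_abs, Real.norm_eq_abs, abs_of_nonpos (by linarith : s - s₁ ≤ 0)] at h3
  have h4 := (abs_le.1 h3).2
  simp only [smul_eq_mul] at h4
  linarith

lemma phi_le {n : ℕ} (hn : 0 < n) {R s₁ : ℝ} (hs₁ : 0 < s₁) (hR : s₁ < R) {ψ ψ1 ψ2 : ℝ → ℝ}
    (hψc : ContinuousOn ψ (Icc 0 s₁)) (hψp : ∀ s ∈ Icc 0 s₁, 0 < ψ s)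
    (hψ1 : ∀ s > 0, HasDerivAt ψ (ψ1 s) s) (hψ2 : ∀ s > 0, HasDerivAt ψ1 (ψ2 s) s)
    (hp : 0 < ψ1 s₁) {c φ : EuclideanSpace ℝ (Fin n) → ℝ}
    (hφc : ContinuousOn φ (closedBall 0 R)) (hφs : ∀ x, ‖x‖ < R → ContDiffAt ℝ 2 φ x)
    (hφl : ∀ x, ‖x‖ < R → lap φ x = c x * φ x) (hφ0 : ∀ x, ‖x‖ = R → φ x = 0)
    (hin : ∀ x, ‖x‖ ≤ R - s₁ → 0 ≤ c x)
    (hout : ∀ x, R - s₁ < ‖x‖ → ‖x‖ < R →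
      ψ2 (R - ‖x‖) - (n - 1) * ψ1 (R - ‖x‖) / ‖x‖ < c x * ψ (R - ‖x‖)) :
    ∀ x, ‖x‖ ≤ R → φ x ≤ 0 := by
  intro xb hxb
  by_contra hcon
  push Not at hcon
  have hR0 : 0 < R := hs₁.trans hR
  set p := ψ1 s₁ with hpdef
  set a := p / (4 * R) with ha
  have ha0 : 0 < a := by positivity
  set Q : ℝ → ℝ := fun r => ψ (min (R - r) s₁) + a * max ((R - s₁)^2 - r^2) 0 with hQ
  have hQout : ∀ r, R - s₁ ≤ r → Q r = ψ (R - r) := by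
    intro r hr
    have h1 : (R - s₁)^2 - r^2 ≤ 0 := by
      have := pow_le_pow_left₀ (by linarith) hr 2
      linarith
    simp only [hQ]
    rw [min_eq_left (by linarith), max_eq_right h1]; ring
  have hQin : ∀ r, 0 ≤ r → r ≤ R - s₁ → Q r = ψ s₁ + a * ((R - s₁)^2 - r^2) := by
    intro r hr0 hr
    have h1 : 0 ≤ (R - s₁)^2 - r^2 := by
      have := pow_le_pow_left₀ hr0 hr 2
      linarith
    simp only [hQ]
    rw [min_eq_right (by linarith), max_eq_left h1]
  have hmin : ∀ r ≤ R, min (R - r) s₁ ∈ Icc 0 s₁ := by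
    intro r hr
    exact ⟨le_min (by linarith) hs₁.le, min_le_right _ _⟩
  have hQp : ∀ r ≤ R, 0 < Q r := by
    intro r hr
    have h1 := hψp _ (hmin r hr)
    have h2 : 0 ≤ a * max ((R - s₁)^2 - r^2) 0 := mul_nonneg ha0.le (le_max_right _ _)
    simp only [hQ]; linarith
  have hQc : ContinuousOn (fun x : EuclideanSpace ℝ (Fin n) => Q ‖x‖) (closedBall 0 R) := by
    simp only [hQ]
    apply ContinuousOn.add
    · apply hψc.comp (f := fun x : EuclideanSpace ℝ (Fin n) => min (R - ‖x‖) s₁)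
      · fun_prop
      · intro x hx
        rw [mem_closedBall_zero_iff] at hx
        exact hmin _ hx
    · fun_prop
  obtain ⟨x₀, hx₀, hmax⟩ := (isCompact_closedBall (0 : EuclideanSpace ℝ (Fin n)) R).exists_isMaxOn
    ⟨xb, mem_closedBall_zero_iff.2 hxb⟩ (hφc.div hQc (fun x hx => by
      rw [mem_closedBall_zero_iff] at hx; exact (hQp _ hx).ne'))
  rw [mem_closedBall_zero_iff] at hx₀
  set τ := φ x₀ / Q ‖x₀‖ with hτ
  have hτ0 : 0 < τ := by
    have h1 : φ xb / Q ‖xb‖ ≤ φ x₀ / Q ‖x₀‖ := hmax (mem_closedBall_zero_iff.2 hxb)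
    exact lt_of_lt_of_le (div_pos hcon (hQp _ hxb)) h1
  have hQ0 := hQp _ hx₀
  have heq : φ x₀ = τ * Q ‖x₀‖ := by rw [hτ]; field_simp
  have hφp : 0 < φ x₀ := by rw [heq]; exact mul_pos hτ0 hQ0
  have hle : ∀ y, ‖y‖ ≤ R → φ y ≤ τ * Q ‖y‖ := by
    intro y hy
    have h1 : φ y / Q ‖y‖ ≤ τ := hmax (mem_closedBall_zero_iff.2 hy)
    rwa [div_le_iff₀ (hQp _ hy)] at h1
  have hxR : ‖x₀‖ < R := by
    rcases hx₀.lt_or_eq with h | h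
    · exact h
    · have := hφ0 x₀ h; linarith
  have hevR : ∀ᶠ y in 𝓝 x₀, ‖y‖ < R := continuous_norm.continuousAt.eventually (gt_mem_nhds hxR)
  have hn0 : (0:ℝ) < n := by exact_mod_cast hn
  rcases le_or_gt ‖x₀‖ (R - s₁) with hcase | hcase
  · obtain ⟨η, hη, hk⟩ := kink (hψ1 s₁ hs₁) hp
    have hev2 : ∀ᶠ y in 𝓝 x₀, ‖y‖ < R - s₁ + η :=
      continuous_norm.continuousAt.eventually (gt_mem_nhds (by linarith))
    have ht := touch_max (n := n) (f := φ) (x := x₀) (c := 0) (hφs x₀ hxR)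
      (G := fun t => τ * (ψ s₁ + a * ((R - s₁)^2 - t))) (G1 := fun _ => τ * (a * -1)) (G2 := 0)
      (Filter.Eventually.of_forall fun t => ((((hasDerivAt_id' t).const_sub _).const_mul a).const_add
        _).const_mul τ) (hasDerivAt_const _ _) (by
        filter_upwards [hevR, hev2] with y hy hy2
        simp only [sub_zero]
        rw [← hQin _ (norm_nonneg _) hcase, heq]
        have h1 := hle y hy.le
        have h2 : Q ‖y‖ ≤ ψ s₁ + a * ((R - s₁)^2 - ‖y‖^2) := by
          rcases le_or_gt ‖y‖ (R - s₁) with h | h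
          · rw [hQin _ (norm_nonneg _) h]
          · rw [hQout _ h.le]
            have h3 := hk (R - ‖y‖) (by linarith) (by linarith)
            have h4 : a * ((‖y‖ - (R - s₁)) * (‖y‖ + (R - s₁))) ≤
                a * ((‖y‖ - (R - s₁)) * (2 * R)) := by
              apply mul_le_mul_of_nonneg_left _ ha0.le
              apply mul_le_mul_of_nonneg_left _ (by linarith)
              linarith
            have h5 : a * ((‖y‖ - (R - s₁)) * (2 * R)) = p / 2 * (‖y‖ - (R - s₁)) := by
              rw [ha]; field_simp; ring
            have h6 : a * ((R - s₁)^2 - ‖y‖^2) = - (a * ((‖y‖ - (R - s₁)) * (‖y‖ + (R - s₁)))) := by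
              ring
            rw [h6]
            linarith
        have h3 := mul_le_mul_of_nonneg_left h2 hτ0.le
        linarith)
    rw [hφl x₀ hxR] at ht
    have h1 := mul_nonneg (hin x₀ hcase) hφp.le
    have h2 : 0 < n * (τ * a) := by positivity
    linarith
  · have hr0 : 0 < ‖x₀‖ := by linarith
    set r := ‖x₀‖ with hr
    have hs0 : 0 < R - r := by linarith
    have hev2 : ∀ᶠ y in 𝓝 x₀, R - s₁ < ‖y‖ :=
      continuous_norm.continuousAt.eventually (lt_mem_nhds hcase)
    have hsq : √(r^2) = r := Real.sqrt_sq hr0.le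
    have hsd : ∀ t > 0, HasDerivAt (fun t => R - √t) (-(1 / (2 * √t))) t := fun t ht =>
      (Real.hasDerivAt_sqrt (ne_of_gt ht)).const_sub R
    have hx0 : ‖x₀ - 0‖ = r := by rw [sub_zero]
    have hcs : ContinuousAt (fun t : ℝ => R - √t) (r^2) := by fun_prop
    have ht := touch_max (n := n) (f := φ) (x := x₀) (c := 0) (hφs x₀ hxR)
      (G := fun t => τ * ψ (R - √t))
      (G1 := fun t => τ * (ψ1 (R - √t) * (-(1 / (2 * √t)))))
      (G2 := τ * ((ψ2 (R - r) * (-(1 / (2 * r)))) * (-(1 / (2 * r))) + ψ1 (R - r) * (1 / (4 * r^3))))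
      (by
        rw [hx0]
        have h1 : ∀ᶠ t in 𝓝 (r^2), 0 < R - √t := hcs.eventually
          (lt_mem_nhds (by simp only [hsq]; exact hs0))
        filter_upwards [h1, Ioi_mem_nhds (show 0 < r^2 by positivity)] with t h2 h3
        exact ((hψ1 _ h2).comp t (hsd t h3)).const_mul τ)
      (by
        rw [hx0]
        have hr2 : 0 < r^2 := by positivity
        have h1 : HasDerivAt (fun t => ψ1 (R - √t)) (ψ2 (R - r) * (-(1 / (2 * r)))) (r^2) := by
          have h2 := hsd (r^2) hr2
          have h3 := hψ2 (R - √(r^2)) (by rw [hsq]; exact hs0)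
          have h4 := h3.comp (r^2) h2
          rw [hsq] at h4
          exact h4
        have h2 : HasDerivAt (fun t => -(1 / (2 * √t))) (1 / (4 * r^3)) (r^2) := by
          have h3 := (((Real.hasDerivAt_sqrt hr2.ne').const_mul 2).fun_inv
            (by rw [hsq]; positivity)).fun_neg
          simp only [one_div]
          refine h3.congr_deriv ?_
          rw [hsq]; field_simp; ring
        have h3 := (h1.fun_mul h2).const_mul τ
        refine h3.congr_deriv ?_
        rw [hsq])
      (by
        filter_upwards [hevR, hev2] with y hy hy2
        simp only [sub_zero]
        rw [Real.sqrt_sq (norm_nonneg y), hsq, ← hQout _ hy2.le, ← hQout r hcase.le, heq]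
        have := hle y hy.le
        linarith)
    rw [hφl x₀ hxR, hx0, hsq, heq, hQout r hcase.le] at ht
    have h1 := mul_lt_mul_of_pos_left (hout x₀ hcase hxR) hτ0
    try rw [← hr] at h1
    have h2 : 4 * r^2 * (τ * ((ψ2 (R - r) * (-(1 / (2 * r)))) * (-(1 / (2 * r))) +
        ψ1 (R - r) * (1 / (4 * r^3)))) + 2 * n * (τ * (ψ1 (R - r) * (-(1 / (2 * r))))) =
        τ * (ψ2 (R - r) - (n - 1) * ψ1 (R - r) / r) := by
      field_simp; ring
    rw [h2] at ht
    linarith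

lemma stmt5_aux {n : ℕ} (hn : 0 < n) {W : ℝ → ℝ} {μ L : ℝ} (hW : ContDiff ℝ 2 W)
    {d : ℝ} (hd : ∀ t : ℝ, μ - d < t → t < μ → 0 ≤ deriv (deriv W) t)
    {U : ℝ → ℝ} {s₁ κ C B δ R : ℝ} {ψ ψ1 ψ2 : ℝ → ℝ} (hs₁ : 0 < s₁) (hκ : 0 < κ) (hC : 0 ≤ C)
    (hψc : ContinuousOn ψ (Icc 0 s₁)) (hψp : ∀ s ∈ Icc 0 s₁, 0 < ψ s)
    (hψ1 : ∀ s > 0, HasDerivAt ψ (ψ1 s) s) (hψ2 : ∀ s > 0, HasDerivAt ψ1 (ψ2 s) s)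
    (hψ2le : ∀ s ∈ Ioc 0 s₁, ψ2 s ≤ deriv (deriv W) (U s) * ψ s - κ)
    (hψ1C : ∀ s ∈ Ioc 0 s₁, |ψ1 s| ≤ C) (hp : 0 < ψ1 s₁)
    (hUr : ∀ s ∈ Icc 0 s₁, U s ∈ Icc 0 μ)
    (hB : ∀ s ∈ Icc 0 s₁, ψ s ≤ B) (hB0 : 0 < B)
    (hδ1 : ∀ a ∈ Icc 0 μ, ∀ b ∈ Icc 0 μ, |a - b| < δ →
      |deriv (deriv W) a - deriv (deriv W) b| < κ / (2 * B))
    (hδ2 : δ ≤ U s₁ - (μ - d)) (hR : s₁ < R) (hR2 : 2 * n * C ≤ κ * (R - s₁))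
    {u : EuclideanSpace ℝ (Fin n) → ℝ} (hu : IsSol R μ L (deriv W) u)
    (hconv : ∀ s ∈ Icc 0 s₁, |prof hn u (R - s) - U s| < δ)
    {φ : EuclideanSpace ℝ (Fin n) → ℝ}
    (hφc : ContinuousOn φ (closedBall 0 R)) (hφs : ∀ x, ‖x‖ < R → ContDiffAt ℝ 2 φ x)
    (hφl : ∀ x, ‖x‖ < R → lap φ x = deriv (deriv W) (u x) * φ x)
    (hφ0 : ∀ x, ‖x‖ = R → φ x = 0) :
    ∀ x, ‖x‖ ≤ R → φ x ≤ 0 := by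
  have hnrm : ∀ r ≥ 0, ‖r • (EuclideanSpace.single (⟨0, hn⟩ : Fin n) (1:ℝ))‖ = r := by
    intro r hr
    rw [norm_smul, EuclideanSpace.norm_single]
    simp [abs_of_nonneg hr]
  refine phi_le hn hs₁ hR hψc hψp hψ1 hψ2 hp (c := fun x => deriv (deriv W) (u x)) hφc hφs hφl hφ0
    ?_ ?_
  · intro x hx
    have h1 : prof hn u (R - s₁) ≤ u x := by
      apply hu.mono
      · rw [hnrm _ (by linarith)]; exact hx
      · rw [hnrm _ (by linarith)]; linarith
    have h2 := (abs_lt.1 (hconv s₁ ⟨hs₁.le, le_rfl⟩)).1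
    exact hd _ (by linarith) (hu.rng x (by linarith)).2
  · intro x hx hxR
    have hx0 : 0 < ‖x‖ := by linarith
    set s := R - ‖x‖ with hs
    have hsI : s ∈ Ioc 0 s₁ := ⟨by linarith, by linarith⟩
    have hsI' : s ∈ Icc 0 s₁ := ⟨hsI.1.le, hsI.2⟩
    have h1 : prof hn u (R - s) = u x := by
      have e : R - s = ‖x‖ := by rw [hs]; ring
      rw [e]
      apply le_antisymm
      · apply hu.mono
        · rw [hnrm _ hx0.le]
        · rw [hnrm _ hx0.le]; exact hxR.le
      · apply hu.mono
        · rw [hnrm _ hx0.le]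
        · exact hxR.le
    have h2 := hconv s hsI'
    rw [h1] at h2
    have hur := hu.rng x hxR
    have h3 := hδ1 (u x) ⟨hur.1.le, hur.2.le⟩ (U s) (hUr s hsI') h2
    rw [lt_div_iff₀ (by positivity)] at h3
    have h4 := hψ2le s hsI
    have h5 := hψp s hsI'
    have h6 := hB s hsI'
    set D := deriv (deriv W) (u x) - deriv (deriv W) (U s) with hD
    have h7 : - (κ / 2) < D * ψ s := by
      have a1 : - |D| * ψ s ≤ D * ψ s := mul_le_mul_of_nonneg_right (neg_abs_le D) h5.le
      have a2 : |D| * ψ s ≤ |D| * B := mul_le_mul_of_nonneg_left h6 (abs_nonneg D)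
      linarith
    have h8 : - (κ / 2) ≤ (n - 1) * ψ1 s / ‖x‖ := by
      rw [le_div_iff₀ hx0]
      have hn1 : (1:ℝ) ≤ n := by exact_mod_cast hn
      have a1 : (n - 1) * (-C) ≤ (n - 1) * ψ1 s :=
        mul_le_mul_of_nonneg_left (abs_le.1 (hψ1C s hsI)).1 (by linarith)
      have a2 : κ * (R - s₁) ≤ κ * ‖x‖ := mul_le_mul_of_nonneg_left hx.le hκ.le
      linarith
    have h9 : deriv (deriv W) (u x) * ψ s = D * ψ s + deriv (deriv W) (U s) * ψ s := by
      rw [hD]; ring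
    rw [h9]
    linarith


theorem stmt5 (n : ℕ) (hn : 0 < n) (W : ℝ → ℝ) (μm μ : ℝ) (hW : CondA'' W μm μ)
    (hW'' : ∃ d > (0:ℝ), ∀ t : ℝ, μ - d < t → t < μ → 0 ≤ deriv (deriv W) t)
    (U : ℝ → ℝ) (hU : IsHetero W μ U)
    (ε D : ℝ) (hε : ε ∈ Set.Ioo 0 μ) (hD : 0 < D)
    (u : ℝ → EuclideanSpace ℝ (Fin n) → ℝ) (R₁ : ℝ)
    (hsol : ∀ R ≥ R₁, ContDiffOn ℝ 2 (u R) (closedBall (0 : EuclideanSpace ℝ (Fin n)) R) ∧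
      (∀ x ∈ ball (0 : EuclideanSpace ℝ (Fin n)) R, lap (u R) x = deriv W (u R x)) ∧
      (∀ x ∈ sphere (0 : EuclideanSpace ℝ (Fin n)) R, u R x = 0) ∧
      (∀ x ∈ ball (0 : EuclideanSpace ℝ (Fin n)) R, 0 < u R x ∧ u R x < μ) ∧
      (∀ x ∈ closedBall (0 : EuclideanSpace ℝ (Fin n)) (R - D), μ - ε ≤ u R x))
    -- the rescaled profiles `u_R(R - ·)` converge in `C¹`, uniformly on compacts, to `𝐔`
    (hconv : ∀ K > (0:ℝ), ∀ δ > (0:ℝ), ∃ R₀ : ℝ, ∀ R : ℝ, R₁ ≤ R → R₀ ≤ R →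
      ∀ s ∈ Set.Icc (0:ℝ) K,
        |prof hn (u R) (R - s) - U s| < δ ∧
        |(-(deriv (prof hn (u R)) (R - s))) - deriv U s| < δ) :
    ∃ R₂ : ℝ, ∀ R : ℝ, R₁ ≤ R → R₂ ≤ R →
      ∀ φ : EuclideanSpace ℝ (Fin n) → ℝ,
        ContDiffOn ℝ 2 φ (closedBall (0 : EuclideanSpace ℝ (Fin n)) R) →
        (∀ x ∈ ball (0 : EuclideanSpace ℝ (Fin n)) R,
          -(lap φ x) + deriv (deriv W) (u R x) * φ x = 0) →
        (∀ x ∈ sphere (0 : EuclideanSpace ℝ (Fin n)) R, φ x = 0) →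
        ∀ x ∈ closedBall (0 : EuclideanSpace ℝ (Fin n)) R, φ x = 0 := by
  obtain ⟨hWc, hμm, hμ, hWμ, hWpos, hWn, -⟩ := hW
  obtain ⟨d, hd0, hd⟩ := hW''
  have hW0 : 0 < W 0 := hWpos 0 ⟨hμm, hμ⟩
  obtain ⟨s₁, κ, C, ψ, ψ1, ψ2, hs₁, hκ, hC, hψc, hψp, hψ1, hψ2, hψ2le, hψ1C, hp, hUs₁, hUr⟩ :=
    barrier hWc hW0 hWn hμ hWμ hU hd0
  obtain ⟨B, hB⟩ := (isCompact_Icc (a := 0) (b := s₁)).exists_bound_of_continuousOn hψc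
  have hB' : ∀ s ∈ Icc 0 s₁, ψ s ≤ B := fun s hs => (le_abs_self _).trans (hB s hs)
  have hB0 : 0 < B := (hψp 0 ⟨le_rfl, hs₁.le⟩).trans_le (hB' 0 ⟨le_rfl, hs₁.le⟩)
  obtain ⟨L, hL0, hL⟩ := lipW hWc 0 μ
  have hW2 : Continuous (deriv (deriv W)) := by
    have h : ContDiff ℝ (1 + 1) W := by rw [one_add_one_eq_two]; exact hWc
    exact h.deriv'.continuous_deriv (by norm_num)
  have huc := (isCompact_Icc (a := 0) (b := μ)).uniformContinuousOn_of_continuous hW2.continuousOn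
  rw [Metric.uniformContinuousOn_iff] at huc
  obtain ⟨δ₁, hδ₁0, hδ₁⟩ := huc (κ / (2 * B)) (by positivity)
  set δ := min δ₁ (U s₁ - (μ - d)) with hδ
  have hδ0 : 0 < δ := lt_min hδ₁0 (by linarith)
  obtain ⟨R₀, hR₀⟩ := hconv s₁ hs₁ δ hδ0
  refine ⟨max R₀ (s₁ + 1 + 2 * n * C / κ), ?_⟩
  intro R hR1 hR2 φ hφ hφl hφ0
  have hR0 : R₀ ≤ R := (le_max_left _ _).trans hR2
  have hRs : s₁ + 1 + 2 * n * C / κ ≤ R := (le_max_right _ _).trans hR2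
  have hq0 : 0 ≤ 2 * n * C / κ := by positivity
  have hRs1 : s₁ < R := by linarith
  have hRk : 2 * n * C ≤ κ * (R - s₁) := by
    have : 2 * n * C / κ ≤ R - s₁ := by linarith
    rw [div_le_iff₀ hκ] at this; linarith
  obtain ⟨hu1, hu2, hu3, hu4, -⟩ := hsol R hR1
  have hnb : ∀ x : EuclideanSpace ℝ (Fin n), ‖x‖ < R → closedBall 0 R ∈ 𝓝 x := fun x hx =>
    mem_of_superset (isOpen_ball.mem_nhds (mem_ball_zero_iff.2 hx)) ball_subset_closedBall
  have hu : IsSol R μ L (deriv W) (u R) :=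
    { n0 := hn
      R0 := hs₁.trans hRs1
      L0 := hL0
      cont := hu1.continuousOn
      smooth := fun x hx => hu1.contDiffAt (hnb x hx)
      eq := fun x hx => hu2 x (mem_ball_zero_iff.2 hx)
      bd := fun x hx => hu3 x (mem_sphere_zero_iff_norm.2 hx)
      rng := fun x hx => hu4 x (mem_ball_zero_iff.2 hx)
      lip := hL }
  have hφs : ∀ x : EuclideanSpace ℝ (Fin n), ‖x‖ < R → ContDiffAt ℝ 2 φ x :=
    fun x hx => hφ.contDiffAt (hnb x hx)
  have hlap : ∀ x : EuclideanSpace ℝ (Fin n), ‖x‖ < R →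
      lap φ x = deriv (deriv W) (u R x) * φ x := fun x hx => by
    have := hφl x (mem_ball_zero_iff.2 hx)
    linarith
  have hφ0' : ∀ x : EuclideanSpace ℝ (Fin n), ‖x‖ = R → φ x = 0 :=
    fun x hx => hφ0 x (mem_sphere_zero_iff_norm.2 hx)
  have hδ1 : ∀ a ∈ Icc 0 μ, ∀ b ∈ Icc 0 μ, |a - b| < δ →
      |deriv (deriv W) a - deriv (deriv W) b| < κ / (2 * B) := fun a ha b hb hab =>
    hδ₁ a ha b hb (hab.trans_le (min_le_left _ _))
  have hcv : ∀ s ∈ Icc 0 s₁, |prof hn (u R) (R - s) - U s| < δ :=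
    fun s hs => (hR₀ R hR1 hR0 s hs).1
  have key1 := stmt5_aux hn hWc hd hs₁ hκ hC hψc hψp hψ1 hψ2 hψ2le hψ1C hp hUr hB' hB0 hδ1
    (min_le_right _ _) hRs1 hRk hu hcv hφ.continuousOn hφs hlap hφ0'
  have key2 := stmt5_aux hn hWc hd hs₁ hκ hC hψc hψp hψ1 hψ2 hψ2le hψ1C hp hUr hB' hB0 hδ1
    (min_le_right _ _) hRs1 hRk hu hcv (φ := fun x => 0 - φ x)
    (continuousOn_const.sub hφ.continuousOn) (fun x hx => contDiffAt_const.sub (hφs x hx))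
    (fun x hx => by
      rw [lap_sub' contDiffAt_const (hφs x hx), hlap x hx]
      have : lap (fun _ : EuclideanSpace ℝ (Fin n) => (0:ℝ)) x = 0 := by simp [lap]
      rw [this]; ring)
    (fun x hx => by rw [hφ0' x hx]; ring)
  intro x hx
  rw [mem_closedBall_zero_iff] at hx
  have h1 := key1 x hx
  have h2 := key2 x hx
  linarith
end
end

section
/- Assume W ∈ C² satisfies condition (a') and W''(μ) > 0. Let ε ∈ (0, μ), D > D' with 𝐔(D') = μ − ε, and let R' and u_R (for R ≥ R') be as in the lemma on minimizers over large balls, i.e. u_R is a radially symmetric global energy minimizing solution of Δu = W'(u) in B_R with u = 0 on ∂B_R satisfying 0 < u_R < μ and u_R ≥ μ − ε on the closed ball of radius R − D. Then there exist positive constants C₅ and C₆, depending only on W and n, such that μ − u_R(r) ≤ C₅ e^{−C₆(R − r)} for all r ∈ [0, R − 2D] and all R ≥ R'. -/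
open Metric Set Filter Pointwise

noncomputable section

/-- The energy functional `J(v; s) = ∫_s (½|∇v|² + W(v))`. -/
def energy {n : ℕ} (W : ℝ → ℝ) (v : EuclideanSpace ℝ (Fin n) → ℝ)
    (s : Set (EuclideanSpace ℝ (Fin n))) : ℝ :=
  ∫ x in s, ((1:ℝ)/2 * ‖fderiv ℝ v x‖^2 + W (v x))

theorem line1 {n : ℕ} {u : EuclideanSpace ℝ (Fin n) → ℝ} {z e : EuclideanSpace ℝ (Fin n)} {t : ℝ}
    (h : ContDiffAt ℝ 2 u (z + t • e)) :
    HasDerivAt (fun s : ℝ => u (z + s • e)) (fderiv ℝ u (z + t • e) e) t := by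
  have h1 : HasFDerivAt u (fderiv ℝ u (z + t • e)) (z + t • e) :=
    (h.differentiableAt (by norm_num)).hasFDerivAt
  have h2 : HasDerivAt (fun s : ℝ => z + s • e) e t := by
    simpa using ((hasDerivAt_id t).smul_const e).const_add z
  exact h1.comp_hasDerivAt t h2

theorem line2 {n : ℕ} {u : EuclideanSpace ℝ (Fin n) → ℝ} {z e : EuclideanSpace ℝ (Fin n)} {t : ℝ}
    (h : ContDiffAt ℝ 2 u (z + t • e)) :
    HasDerivAt (fun s : ℝ => fderiv ℝ u (z + s • e) e)
      (fderiv ℝ (fun y => fderiv ℝ u y e) (z + t • e) e) t := by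
  have h0 : ContDiffAt ℝ 1 (fderiv ℝ u) (z + t • e) := h.fderiv_right (by norm_num)
  have h1' : DifferentiableAt ℝ (fun y => fderiv ℝ u y e) (z + t • e) :=
    (h0.differentiableAt (by norm_num)).clm_apply (differentiableAt_const e)
  have h1 := h1'.hasFDerivAt
  have h2 : HasDerivAt (fun s : ℝ => z + s • e) e t := by
    simpa using ((hasDerivAt_id t).smul_const e).const_add z
  exact h1.comp_hasDerivAt t h2

theorem second_nonpos {p p' : ℝ → ℝ} {a : ℝ} (hmax : IsLocalMax p 0)
    (h1 : ∀ᶠ t in nhds (0:ℝ), HasDerivAt p (p' t) t) (h2 : HasDerivAt p' a 0) : a ≤ 0 := by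
  by_contra! ha
  have e1 : deriv p =ᶠ[nhds 0] p' := h1.mono fun t ht => ht.deriv
  have e2 : deriv (deriv p) 0 = a := by rw [e1.deriv_eq, h2.deriv]
  have hmin : IsLocalMin p 0 :=
    isLocalMin_of_deriv_deriv_pos (by rw [e2]; exact ha) hmax.deriv_eq_zero
      h1.self_of_nhds.continuousAt
  have hc : p =ᶠ[nhds 0] fun _ => p 0 := by
    filter_upwards [hmin, hmax] with t h h'
    exact le_antisymm h' h
  have := hc.deriv.deriv_eq
  rw [e2] at this
  simp at this
  linarith

/-- Barrier estimate. -/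
theorem barrier_s6 {n : ℕ} (hn : 0 < n) {u : EuclideanSpace ℝ (Fin n) → ℝ} {W : ℝ → ℝ} {μ ε c k : ℝ}
    {x : EuclideanSpace ℝ (Fin n)} {ρ : ℝ} (hρ : 0 < ρ) (hk : 0 < k) (hkc : k ^ 2 = c)
    (hε : 0 < ε)
    (hu : ∀ y ∈ closedBall x ρ, ContDiffAt ℝ 2 u y)
    (hlap : ∀ y ∈ ball x ρ, lap u y = deriv W (u y))
    (hub : ∀ y ∈ closedBall x ρ, μ - ε ≤ u y ∧ u y ≤ μ)
    (hW : ∀ t, μ - ε ≤ t → t ≤ μ → c * (μ - t) ≤ - deriv W t) :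
    μ - u x ≤ 2 * ε * n * Real.exp (-(k / n) * ρ) := by
  have hn' : (0:ℝ) < n := by exact_mod_cast hn
  set l : ℝ := 2 * ε * Real.exp (-(k / n) * ρ) with hl
  have hlpos : 0 < l := by positivity
  set φ : EuclideanSpace ℝ (Fin n) → ℝ := fun y => ∑ i, Real.cosh (k * (y i - x i)) with hφ
  have hφx : φ x = n := by simp [hφ]
  set ψ : EuclideanSpace ℝ (Fin n) → ℝ := fun y => μ - u y - l * φ y with hψ
  have hψc : ContinuousOn ψ (closedBall x ρ) := by
    have h1 : ContinuousOn u (closedBall x ρ) := fun y hy =>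
      (hu y hy).continuousAt.continuousWithinAt
    have h2 : Continuous φ := by
      refine continuous_finsetSum _ fun i _ => Real.continuous_cosh.comp ?_
      fun_prop
    exact (continuousOn_const.sub h1).sub (h2.const_smul l).continuousOn
  obtain ⟨y, hy, hymax⟩ := (isCompact_closedBall x ρ).exists_isMaxOn
    ⟨x, mem_closedBall_self hρ.le⟩ hψc
  have key : ψ y ≤ 0 := by
    by_contra! hpos
    have hylt : y ∈ ball x ρ := by
      rw [mem_ball]
      rcases lt_or_eq_of_le (mem_closedBall.1 hy) with h | h
      · exact h
      exfalso
      have hex : ∃ i, ρ / n ≤ |y i - x i| := by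
        by_contra! hcon
        have h1 : ‖y - x‖ ^ 2 = ∑ i, (y i - x i) ^ 2 := by
          rw [EuclideanSpace.norm_sq_eq]; simp
        have h2 : ∑ i, (y i - x i) ^ 2 < ∑ i : Fin n, (ρ / n) ^ 2 := by
          refine Finset.sum_lt_sum_of_nonempty ⟨⟨0, hn⟩, Finset.mem_univ _⟩ fun i _ => ?_
          rw [← sq_abs]
          exact pow_lt_pow_left₀ (hcon i) (abs_nonneg _) (by norm_num)
        rw [← h1, ← dist_eq_norm, h] at h2
        simp at h2
        have h3 : (n:ℝ) * (ρ / n) ^ 2 ≤ ρ ^ 2 := by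
          have : (n:ℝ) * (ρ / n) ^ 2 = ρ ^ 2 / n := by field_simp
          rw [this]
          exact div_le_self (by positivity) (by exact_mod_cast hn)
        linarith
      obtain ⟨i, hi⟩ := hex
      have h1 : Real.cosh (k * (y i - x i)) ≤ φ y :=
        Finset.single_le_sum (f := fun i => Real.cosh (k * (y i - x i)))
          (fun j _ => (Real.cosh_pos _).le) (Finset.mem_univ i)
      have h2 : Real.exp (k * (ρ / n)) / 2 ≤ Real.cosh (k * (y i - x i)) := by
        rw [← Real.cosh_abs, abs_mul, abs_of_pos hk, Real.cosh_eq]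
        have := Real.exp_le_exp.2 (mul_le_mul_of_nonneg_left hi hk.le)
        have := Real.exp_pos (-(k * |y i - x i|))
        linarith
      have h3 : l * (Real.exp (k * (ρ / n)) / 2) = ε := by
        rw [hl]
        have : Real.exp (-(k / n) * ρ) * Real.exp (k * (ρ / n)) = 1 := by
          rw [← Real.exp_add]
          rw [show -(k / n) * ρ + k * (ρ / n) = 0 by ring, Real.exp_zero]
        linear_combination ε * this
      have h4 : ε ≤ l * φ y := by
        rw [← h3]; exact mul_le_mul_of_nonneg_left (h2.trans h1) hlpos.le
      have := (hub y hy).1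
      simp only [hψ] at hpos
      linarith
    have hloc : IsLocalMax ψ y := hymax.isLocalMax (closedBall_mem_nhds_of_mem hylt)
    have hi : ∀ i : Fin n, - fderiv ℝ (fun z => fderiv ℝ u z (EuclideanSpace.single i 1)) y
        (EuclideanSpace.single i 1) - l * (k ^ 2 * Real.cosh (k * (y i - x i))) ≤ 0 := by
      intro i
      set e : EuclideanSpace ℝ (Fin n) := EuclideanSpace.single i 1 with he
      have hcont : Continuous (fun t : ℝ => y + t • e) := by fun_prop
      have hmem : ∀ᶠ t in nhds (0:ℝ), y + t • e ∈ ball x ρ := by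
        apply hcont.continuousAt.eventually_mem
        simpa using isOpen_ball.mem_nhds hylt
      set q : ℝ → ℝ := fun t => μ - u (y + t • e) -
        l * (Real.cosh (k * (y i + t - x i)) +
          ∑ j ∈ Finset.univ.erase i, Real.cosh (k * (y j - x j))) with hq
      have hqψ : ∀ t, q t = ψ (y + t • e) := by
        intro t
        simp only [hq, hψ, hφ]
        rw [← Finset.add_sum_erase _ _ (Finset.mem_univ i)]
        congr 3
        · simp [he]
        · refine Finset.sum_congr rfl fun j hj => ?_
          have : j ≠ i := (Finset.mem_erase.1 hj).1
          simp [he, this]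
      have hqmax : IsLocalMax q 0 := by
        have h0 : Tendsto (fun t : ℝ => y + t • e) (nhds 0) (nhds y) := by
          simpa using hcont.tendsto 0
        have := h0.eventually hloc
        filter_upwards [this] with t ht
        rw [hqψ, hqψ]; simpa using ht
      refine second_nonpos (p := q) (p' := fun t => - fderiv ℝ u (y + t • e) e -
        l * (k * Real.sinh (k * (y i + t - x i)))) hqmax ?_ ?_
      · filter_upwards [hmem] with t ht
        have a1 := line1 (hu _ (ball_subset_closedBall ht))
        have a2 : HasDerivAt (fun t : ℝ => k * (y i + t - x i)) k t := by
          simpa using (((hasDerivAt_id t).const_add (y i)).sub_const (x i)).const_mul k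
        have a3 := ((a2.cosh.add_const
          (∑ j ∈ Finset.univ.erase i, Real.cosh (k * (y j - x j)))).const_mul l)
        have := (a1.const_sub μ).sub a3
        refine this.congr_deriv ?_
        ring
      · have a1 := line2 (t := 0) (z := y) (e := e) (u := u)
          (by simpa using hu y hy)
        have a2 : HasDerivAt (fun t : ℝ => k * (y i + t - x i)) k 0 := by
          simpa using (((hasDerivAt_id (0:ℝ)).const_add (y i)).sub_const (x i)).const_mul k
        have := a1.neg.sub ((a2.sinh.const_mul k).const_mul l)
        refine this.congr_deriv ?_
        rw [zero_smul, add_zero, add_zero]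
        ring
    have hsum := Finset.sum_nonpos (s := Finset.univ) fun i _ => hi i
    rw [Finset.sum_sub_distrib, Finset.sum_neg_distrib, ← Finset.mul_sum, ← Finset.mul_sum] at hsum
    have e1 := hlap y hylt
    simp only [lap] at e1
    rw [e1] at hsum
    have e2 := hW (u y) (hub y hy).1 (hub y hy).2
    simp only [hψ] at hpos
    have hc : 0 < c := by rw [← hkc]; positivity
    have e3 : c * (μ - u y) ≤ c * (l * φ y) := by
      rw [hkc] at hsum
      simp only [hφ]
      nlinarith
    have := le_of_mul_le_mul_left e3 hc
    linarith
  have := (hymax (mem_closedBall_self hρ.le)).trans key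
  simp only [hψ, hφx] at this
  rw [show 2 * ε * n * Real.exp (-(k / n) * ρ) = l * n by rw [hl]; ring]
  linarith

theorem smono {n : ℕ} (hn : 0 < n) {u : EuclideanSpace ℝ (Fin n) → ℝ} {W : ℝ → ℝ} {R : ℝ}
    (hWd : Differentiable ℝ W)
    (hu : ∀ y ∈ ball (0 : EuclideanSpace ℝ (Fin n)) R, ContDiffAt ℝ 2 u y)
    (hlap : ∀ y ∈ ball (0 : EuclideanSpace ℝ (Fin n)) R, lap u y = deriv W (u y))
    (hrad : ∀ y ∈ ball (0 : EuclideanSpace ℝ (Fin n)) R, u y = prof hn u ‖y‖)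
    {r1 : ℝ} (hr1 : 0 ≤ r1) (hr1R : r1 < R) :
    ∃ s ∈ Icc 0 r1, (∀ r ∈ Icc 0 r1, prof hn u s ≤ prof hn u r) ∧
      (s = r1 ∨ W (prof hn u s) ≤ W (prof hn u r1)) := by
  set i0 : Fin n := ⟨0, hn⟩ with hi0
  set e : EuclideanSpace ℝ (Fin n) := EuclideanSpace.single i0 1 with he
  have hen : ‖e‖ = 1 := by simp [he]
  set g : ℝ → ℝ := prof hn u with hg
  have hgd : ∀ r, g r = u (r • e) := fun r => rfl
  set g' : ℝ → ℝ := fun r => fderiv ℝ u (r • e) e with hg'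
  have hball : ∀ r, |r| < R → r • e ∈ ball (0 : EuclideanSpace ℝ (Fin n)) R := by
    intro r hr; simpa [norm_smul, hen] using hr
  have d1 : ∀ r, |r| < R → HasDerivAt g (g' r) r := by
    intro r hr
    have := line1 (z := 0) (e := e) (t := r) (u := u) (by simpa using hu _ (hball r hr))
    simp only [zero_add] at this
    exact this
  set g2 : ℝ → ℝ := fun r => fderiv ℝ (fun z => fderiv ℝ u z e) (r • e) e with hg2
  have d2 : ∀ r, |r| < R → HasDerivAt g' (g2 r) r := by
    intro r hr
    have := line2 (z := 0) (e := e) (t := r) (u := u) (by simpa using hu _ (hball r hr))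
    simpa using this
  have hR : 0 < R := hr1.trans_lt hr1R
  have heven : ∀ r, |r| < R → g (-r) = g r := by
    intro r hr
    have h1 := hrad _ (hball r hr)
    have h2 := hrad _ (hball (-r) (by simpa using hr))
    rw [← hgd] at h1 h2
    rw [h1, h2]; simp
  have hg0 : g' 0 = 0 := by
    have h0 : |(0:ℝ)| < R := by simpa using hR
    have a := d1 0 h0
    have b : HasDerivAt (fun r => g (-r)) (- g' 0) 0 := by
      have a' : HasDerivAt g (g' 0) (-(0:ℝ)) := by simpa using a
      have := a'.comp (0:ℝ) (hasDerivAt_neg (0:ℝ))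
      exact this.congr_deriv (by ring)
    have hev : (fun r => g (-r)) =ᶠ[nhds 0] g := by
      have : ∀ᶠ r in nhds (0:ℝ), |r| < R :=
        continuous_abs.continuousAt.eventually_lt continuousAt_const h0
      filter_upwards [this] with r hr using heven r hr
    have := (b.congr_of_eventuallyEq hev.symm).unique a
    linarith
  -- the radial equation
  have hode : ∀ r, 0 < r → r < R → g2 r + (n - 1) * (g' r / r) = deriv W (g r) := by
    intro r hr hrR
    have hab : |r| < R := by rwa [abs_of_pos hr]
    have h1 := hlap _ (hball r hab)
    rw [← hgd] at h1
    rw [← h1, lap, ← Finset.add_sum_erase _ _ (Finset.mem_univ i0)]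
    congr 1
    have : ∀ j ∈ Finset.univ.erase i0,
        fderiv ℝ (fun y => fderiv ℝ u y (EuclideanSpace.single j 1)) (r • e)
          (EuclideanSpace.single j 1) = g' r / r := by
      intro j hj
      have hji : j ≠ i0 := (Finset.mem_erase.1 hj).1
      set f : EuclideanSpace ℝ (Fin n) := EuclideanSpace.single j 1 with hf
      have hnorm : ∀ t : ℝ, ‖r • e + t • f‖ = √(r ^ 2 + t ^ 2) := by
        intro t
        rw [← Real.sqrt_sq (norm_nonneg (r • e + t • f))]
        congr 1
        have ho : inner ℝ (r • e) (t • f) = 0 := by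
          rw [inner_smul_left, inner_smul_right, he, hf, EuclideanSpace.inner_single_left]
          simp [hji.symm]
        have := norm_add_sq_eq_norm_sq_add_norm_sq_of_inner_eq_zero _ _ ho
        rw [sq, this]
        simp [norm_smul, hen, hf]
        ring
      have hpos : ∀ t : ℝ, 0 < r ^ 2 + t ^ 2 := fun t => by positivity
      have hnear : ∀ᶠ t in nhds (0:ℝ), √(r ^ 2 + t ^ 2) < R := by
        have hc : ContinuousAt (fun t : ℝ => √(r ^ 2 + t ^ 2)) 0 := by fun_prop
        refine hc.eventually_lt continuousAt_const ?_
        simpa [Real.sqrt_sq hr.le] using hrR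
      have hmem : ∀ t, √(r ^ 2 + t ^ 2) < R → r • e + t • f ∈
          ball (0 : EuclideanSpace ℝ (Fin n)) R := by
        intro t ht; rw [mem_ball_zero_iff, hnorm]; exact ht
      have hev : (fun t : ℝ => u (r • e + t • f)) =ᶠ[nhds 0] fun t => g (√(r ^ 2 + t ^ 2)) := by
        filter_upwards [hnear] with t ht
        rw [hrad _ (hmem t ht), hnorm]
      set q : ℝ → ℝ := fun t => g' (√(r ^ 2 + t ^ 2)) / √(r ^ 2 + t ^ 2) with hq
      have hder : (fun t : ℝ => fderiv ℝ u (r • e + t • f) f) =ᶠ[nhds 0] fun t => q t * t := by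
        filter_upwards [hnear, hev.eventuallyEq_nhds] with t ht hevt
        have a := line1 (hu _ (hmem t ht))
        have b : HasDerivAt (fun t : ℝ => √(r ^ 2 + t ^ 2)) (t / √(r ^ 2 + t ^ 2)) t := by
          have c1 : HasDerivAt (fun t : ℝ => r ^ 2 + t ^ 2) (2 * t) t := by
            simpa using (hasDerivAt_pow 2 t).const_add (r ^ 2)
          convert c1.sqrt (hpos t).ne' using 1
          have : √(r ^ 2 + t ^ 2) ≠ 0 := (Real.sqrt_pos.2 (hpos t)).ne'
          field_simp
        have hs : |√(r ^ 2 + t ^ 2)| < R := by rwa [abs_of_nonneg (Real.sqrt_nonneg _)]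
        have c := (d1 _ hs).comp t b
        have c' := c.congr_of_eventuallyEq hevt
        rw [a.unique c', hq]
        ring
      have a2 := line2 (z := r • e) (e := f) (t := 0) (u := u) (by simpa using hu _ (hball r hab))
      have q0 : √(r ^ 2 + (0:ℝ) ^ 2) = r := by simp [Real.sqrt_sq hr.le]
      have hqc : ContinuousAt q 0 := by
        have c1 : ContinuousAt (fun t : ℝ => √(r ^ 2 + t ^ 2)) 0 := by fun_prop
        have c2 : ContinuousAt g' (√(r ^ 2 + (0:ℝ) ^ 2)) := by
          rw [q0]; exact (d2 r hab).continuousAt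
        exact (ContinuousAt.comp (f := fun t : ℝ => √(r ^ 2 + t ^ 2)) c2 c1).div c1
          (by rw [q0]; exact hr.ne')
      have b2 : HasDerivAt (fun t => q t * t) (q 0) 0 := by
        rw [hasDerivAt_iff_tendsto_slope]
        refine (hqc.tendsto.mono_left nhdsWithin_le_nhds).congr' ?_
        filter_upwards [self_mem_nhdsWithin] with t ht
        have : t ≠ 0 := ht
        simp [slope_def_field, this]
      have := a2.unique (b2.congr_of_eventuallyEq hder)
      rw [zero_smul, add_zero] at this
      rw [this, hq]
      simp only [q0]
    rw [Finset.sum_congr rfl this]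
    simp [Finset.card_erase_of_mem]
    left
    rw [Nat.cast_sub (by omega)]; simp
  have hcg : ContinuousOn g (Icc 0 r1) := fun r hr =>
    (d1 r (by rw [abs_of_nonneg hr.1]; exact hr.2.trans_lt hr1R)).continuousAt.continuousWithinAt
  obtain ⟨s, hs, hsmin⟩ := isCompact_Icc.exists_isMinOn (nonempty_Icc.2 hr1) hcg
  refine ⟨s, hs, fun r hr => hsmin hr, ?_⟩
  rcases eq_or_lt_of_le hs.2 with h | h
  · exact Or.inl h
  right
  have hs0 : g' s = 0 := by
    rcases eq_or_lt_of_le hs.1 with h0 | h0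
    · rw [← h0]; exact hg0
    · have hl : IsLocalMin g s := hsmin.isLocalMin (Icc_mem_nhds h0 h)
      exact hl.hasDerivAt_eq_zero (d1 s (by rw [abs_of_pos h0]; linarith))
  have hE : ∀ r, |r| < R → HasDerivAt (fun r => g' r ^ 2 / 2 - W (g r))
      (g' r * (g2 r - deriv W (g r))) r := by
    intro r hr
    have a := ((d2 r hr).pow 2).div_const 2
    have b := (hWd (g r)).hasDerivAt.comp r (d1 r hr)
    refine (a.sub b).congr_deriv ?_
    simp
    ring
  have hanti : AntitoneOn (fun r => g' r ^ 2 / 2 - W (g r)) (Icc 0 r1) := by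
    refine antitoneOn_of_deriv_nonpos (convex_Icc _ _) ?_ ?_ ?_
    · intro r hr
      have hrR := hr.2.trans_lt hr1R
      exact (hE r (by rw [abs_of_nonneg hr.1]; exact hrR)).continuousAt.continuousWithinAt
    · intro r hr
      rw [interior_Icc] at hr
      have hrR := hr.2.trans hr1R
      exact (hE r (by rw [abs_of_pos hr.1]; exact hrR)).differentiableAt.differentiableWithinAt
    · intro r hr
      rw [interior_Icc] at hr
      have hrR := hr.2.trans hr1R
      rw [(hE r (by rw [abs_of_pos hr.1]; exact hrR)).deriv, ← hode r hr.1 hrR]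
      have hn1 : (1:ℝ) ≤ n := by exact_mod_cast hn
      have : g' r * (g2 r - (g2 r + (n - 1) * (g' r / r))) = - ((n - 1) * (g' r ^ 2 / r)) := by
        ring
      rw [this]
      have h1 : 0 ≤ g' r ^ 2 / r := div_nonneg (sq_nonneg _) hr.1.le
      have h2 : (0:ℝ) ≤ n - 1 := by linarith
      have := mul_nonneg h2 h1
      linarith
  have := hanti hs (right_mem_Icc.2 hr1) hs.2
  simp only [hs0] at this
  nlinarith [sq_nonneg (g' r1)]

open MeasureTheory in
theorem vol_shell {n : ℕ} (hn : 0 < n) {R d : ℝ} (hd : 0 < d) (hdR : d ≤ R) :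
    (volume : Measure (EuclideanSpace ℝ (Fin n))).real
      (ball (0 : EuclideanSpace ℝ (Fin n)) R \ ball 0 (R - d)) =
      (R ^ n - (R - d) ^ n) *
        (volume : Measure (EuclideanSpace ℝ (Fin n))).real (ball (0 : EuclideanSpace ℝ (Fin n)) 1) := by
  haveI : Nonempty (Fin n) := ⟨⟨0, hn⟩⟩
  have h : ∀ r : ℝ, 0 ≤ r → (volume : Measure (EuclideanSpace ℝ (Fin n))).real
      (ball (0 : EuclideanSpace ℝ (Fin n)) r) = r ^ n *
        (volume : Measure (EuclideanSpace ℝ (Fin n))).real (ball (0 : EuclideanSpace ℝ (Fin n)) 1) := by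
    intro r hr
    rw [← Measure.addHaar_real_closedBall_eq_addHaar_real_ball, Measure.addHaar_real_closedBall _ _ hr]
    simp
  rw [measureReal_sdiff (ball_subset_ball (by linarith)) measurableSet_ball measure_ball_lt_top.ne,
    h R (by linarith), h (R - d) (by linarith)]
  ring

theorem pow_upper {n : ℕ} {R : ℝ} (hR : 1 ≤ R) : R ^ n - (R - 1) ^ n ≤ n * R ^ (n - 1) := by
  rcases Nat.eq_zero_or_pos n with rfl | hn
  · simp
  have hR0 : 0 < R := by linarith
  have h := one_add_mul_le_pow (a := -(1 / R)) (by
    have : 1 / R ≤ 1 := by rw [div_le_one hR0]; exact hR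
    linarith) n
  have h2 : (R - 1) ^ n = R ^ n * (1 + -(1 / R)) ^ n := by
    rw [← mul_pow]; congr 1; field_simp; ring
  have h3 : R ^ n = R * R ^ (n - 1) := by
    rw [← pow_succ', Nat.sub_add_cancel hn]
  have h4 := mul_le_mul_of_nonneg_left h (pow_pos hR0 n).le
  rw [← h2] at h4
  have h5 : R ^ n * (1 + n * -(1 / R)) = R ^ n - n * R ^ (n - 1) := by
    rw [h3]; field_simp; ring
  linarith

theorem pow_lower {n : ℕ} (hn : 0 < n) {R d : ℝ} (hd : 0 ≤ d) (hR : d ≤ R) :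
    d * R ^ (n - 1) ≤ R ^ n - (R - d) ^ n := by
  have h3 : ∀ x : ℝ, x ^ n = x * x ^ (n - 1) := fun x => by
    rw [← pow_succ', Nat.sub_add_cancel hn]
  rw [h3 R, h3 (R - d)]
  have : (R - d) ^ (n - 1) ≤ R ^ (n - 1) := pow_le_pow_left₀ (by linarith) (by linarith) _
  nlinarith

/-- The competitor. -/
def comp {n : ℕ} (μ R : ℝ) (x : EuclideanSpace ℝ (Fin n)) : ℝ :=
  μ * Real.smoothTransition ((R ^ 2 - ‖x‖ ^ 2) / R)

theorem comp_contDiff {n : ℕ} (μ R : ℝ) :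
    ContDiff ℝ 1 (comp μ R : EuclideanSpace ℝ (Fin n) → ℝ) := by
  unfold comp
  refine contDiff_const.mul ((Real.smoothTransition.contDiff (n := 1)).comp ?_)
  exact (contDiff_const.sub (contDiff_norm_sq ℝ)).div_const R

theorem comp_energy (W : ℝ → ℝ) (hWc : Continuous W) (μ : ℝ) (hμ : 0 < μ) (hWμ : W μ = 0)
    (hW0 : ∀ t, 0 ≤ W t) :
    ∃ C : ℝ, 0 < C ∧ ∀ (n : ℕ) (R : ℝ) (x : EuclideanSpace ℝ (Fin n)), 1 ≤ R → ‖x‖ < R →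
      (1:ℝ)/2 * ‖fderiv ℝ (comp μ R) x‖^2 + W (comp μ R x) ≤
        (ball (0 : EuclideanSpace ℝ (Fin n)) R \ ball 0 (R - 1)).indicator (fun _ => C) x := by
  have hsd : ContDiff ℝ 1 Real.smoothTransition := Real.smoothTransition.contDiff (n := 1)
  have hsc : Continuous (deriv Real.smoothTransition) := hsd.continuous_deriv (by norm_num)
  obtain ⟨K, hK⟩ := isCompact_Icc.exists_bound_of_continuousOn (s := Icc (0:ℝ) 1) hsc.continuousOn
  obtain ⟨M, hM⟩ := isCompact_Icc.exists_bound_of_continuousOn (s := Icc (0:ℝ) μ) hWc.continuousOn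
  have hK0 : 0 ≤ K := (norm_nonneg _).trans (hK 0 (by simp))
  have hM0 : 0 ≤ M := (norm_nonneg _).trans (hM 0 (by simp [hμ.le]))
  have hone : ∀ t : ℝ, 1 ≤ t → deriv Real.smoothTransition t = 0 := by
    intro t ht
    apply IsLocalMax.deriv_eq_zero
    refine Eventually.of_forall fun s => ?_
    rw [Real.smoothTransition.one_of_one_le ht]
    exact Real.smoothTransition.le_one s
  refine ⟨(1:ℝ)/2 * (μ * K * 2) ^ 2 + M + 1, by positivity, ?_⟩
  intro n R x hR hx
  have hR0 : 0 < R := by linarith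
  set t : ℝ := (R ^ 2 - ‖x‖ ^ 2) / R with ht
  have ht0 : 0 ≤ t := div_nonneg (by nlinarith [norm_nonneg x]) hR0.le
  have hder : HasFDerivAt (comp μ R : EuclideanSpace ℝ (Fin n) → ℝ)
      ((μ * deriv Real.smoothTransition t * (-2 / R)) • innerSL ℝ x) x := by
    have h1 : HasFDerivAt (fun y : EuclideanSpace ℝ (Fin n) => (R ^ 2 - ‖y‖ ^ 2) / R)
        ((-2 / R) • innerSL ℝ x) x := by
      have a := (hasStrictFDerivAt_norm_sq x).hasFDerivAt
      have b := (a.const_sub (R ^ 2)).mul_const (R⁻¹)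
      refine (b.congr_fderiv ?_).congr_of_eventuallyEq
        (Eventually.of_forall fun y => by simp [div_eq_mul_inv])
      ext y
      simp
      ring
    have h2 : HasDerivAt Real.smoothTransition (deriv Real.smoothTransition t) t :=
      (hsd.differentiable (by norm_num) t).hasDerivAt
    have h3 := (h2.comp_hasFDerivAt x h1).const_mul μ
    refine h3.congr_fderiv ?_
    ext y
    simp
    ring
  rw [hder.fderiv, norm_smul, innerSL_apply_norm]
  by_cases hin : ‖x‖ < R - 1
  · have ht1 : 1 ≤ t := by
      rw [ht, le_div_iff₀ hR0]
      nlinarith [norm_nonneg x]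
    rw [indicator_of_notMem (by simp [hin]), hone t ht1]
    have : comp μ R x = μ := by
      simp only [comp]; rw [← ht, Real.smoothTransition.one_of_one_le ht1, mul_one]
    rw [this, hWμ]; simp
  · rw [indicator_of_mem (by simpa using ⟨hx, by linarith⟩)]
    have hd : |deriv Real.smoothTransition t| ≤ K := by
      rcases le_total 1 t with h | h
      · rw [hone t h]; simpa using hK0
      · simpa using hK t ⟨ht0, h⟩
    have h1 : ‖μ * deriv Real.smoothTransition t * (-2 / R)‖ * ‖x‖ ≤ μ * K * 2 := by
      rw [norm_mul, norm_mul, Real.norm_eq_abs, Real.norm_eq_abs, Real.norm_eq_abs,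
        abs_of_pos hμ, abs_div, abs_of_pos hR0]
      have e1 : |(-2:ℝ)| / R * ‖x‖ ≤ 2 := by
        rw [abs_neg, abs_of_pos (by norm_num : (0:ℝ) < 2), div_mul_eq_mul_div, div_le_iff₀ hR0]
        nlinarith
      rw [mul_assoc]
      exact mul_le_mul (mul_le_mul_of_nonneg_left hd hμ.le) e1 (by positivity) (by positivity)
    have h2 := pow_le_pow_left₀ (by positivity) h1 2
    have h3 : W (comp μ R x) ≤ M := by
      refine (le_abs_self _).trans (hM _ ⟨?_, ?_⟩)
      · exact mul_nonneg hμ.le (Real.smoothTransition.nonneg _)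
      · exact mul_le_of_le_one_right hμ.le (Real.smoothTransition.le_one _)
    linarith

open MeasureTheory in
theorem energy_integrable {n : ℕ} {W : ℝ → ℝ} (hWc : Continuous W)
    {u : EuclideanSpace ℝ (Fin n) → ℝ} {R : ℝ} (hR : 0 < R)
    (hu : ContDiffOn ℝ 2 u (closedBall (0 : EuclideanSpace ℝ (Fin n)) R)) :
    IntegrableOn (fun x => (1:ℝ)/2 * ‖fderiv ℝ u x‖^2 + W (u x))
      (ball (0 : EuclideanSpace ℝ (Fin n)) R) := by
  have hud : UniqueDiffOn ℝ (closedBall (0 : EuclideanSpace ℝ (Fin n)) R) := by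
    refine uniqueDiffOn_convex (convex_closedBall _ _) ⟨0, ?_⟩
    exact ball_subset_interior_closedBall (mem_ball_self hR)
  have h1 := hu.continuousOn_fderivWithin hud (by norm_num)
  have h2 : ContinuousOn (fun x => (1:ℝ)/2 *
      ‖fderivWithin ℝ u (closedBall (0 : EuclideanSpace ℝ (Fin n)) R) x‖^2 + W (u x))
      (closedBall (0 : EuclideanSpace ℝ (Fin n)) R) :=
    (continuousOn_const.mul (h1.norm.pow 2)).add (hWc.comp_continuousOn hu.continuousOn)
  have h3 := (h2.integrableOn_compact (μ := volume) (isCompact_closedBall _ _)).mono_set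
    ball_subset_closedBall
  refine h3.congr_fun (fun x hx => ?_) measurableSet_ball
  simp only
  rw [fderivWithin_of_mem_nhds (closedBall_mem_nhds_of_mem hx)]

open MeasureTheory in
theorem exists_good {n : ℕ} (hn : 0 < n) {W : ℝ → ℝ} (hWc : Continuous W) {μ : ℝ}
    (hW0 : ∀ t, 0 ≤ W t) {C m d : ℝ} (hm : 0 < m)
    (hC : ∀ (n : ℕ) (R : ℝ) (x : EuclideanSpace ℝ (Fin n)), 1 ≤ R → ‖x‖ < R →
      (1:ℝ)/2 * ‖fderiv ℝ (comp μ R) x‖^2 + W (comp μ R x) ≤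
        (ball (0 : EuclideanSpace ℝ (Fin n)) R \ ball 0 (R - 1)).indicator (fun _ => C) x)
    (hC0 : 0 < C) (hd1 : 1 ≤ d) (hd : n * C < m * d)
    {u : EuclideanSpace ℝ (Fin n) → ℝ} {R : ℝ} (hR : d ≤ R)
    (hu : ContDiffOn ℝ 2 u (closedBall (0 : EuclideanSpace ℝ (Fin n)) R))
    (hmin : ∀ v : EuclideanSpace ℝ (Fin n) → ℝ,
          ContDiffOn ℝ 1 v (closedBall (0 : EuclideanSpace ℝ (Fin n)) R) →
          (∀ x ∈ sphere (0 : EuclideanSpace ℝ (Fin n)) R, v x = 0) →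
          energy W u (ball (0 : EuclideanSpace ℝ (Fin n)) R) ≤
            energy W v (ball (0 : EuclideanSpace ℝ (Fin n)) R)) :
    ∃ x : EuclideanSpace ℝ (Fin n), R - d ≤ ‖x‖ ∧ ‖x‖ < R ∧ W (u x) < m := by
  by_contra! hcon
  have hR1 : 1 ≤ R := hd1.trans hR
  have hR0 : 0 < R := by linarith
  have h1 := hmin (comp μ R) (comp_contDiff μ R).contDiffOn (by
    intro x hx
    rw [mem_sphere_zero_iff_norm] at hx
    simp [comp, hx, Real.smoothTransition.zero])
  have key : ∀ (s a : ℝ), IntegrableOn ((ball (0 : EuclideanSpace ℝ (Fin n)) R \ ball 0 (R - s)).indicator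
        (fun _ => a)) (ball 0 R) ∧
      ∫ x in ball (0 : EuclideanSpace ℝ (Fin n)) R,
        (ball (0 : EuclideanSpace ℝ (Fin n)) R \ ball 0 (R - s)).indicator (fun _ => a) x =
      (volume : Measure (EuclideanSpace ℝ (Fin n))).real
        (ball (0 : EuclideanSpace ℝ (Fin n)) R \ ball 0 (R - s)) * a := by
    intro s a
    have hmeas : MeasurableSet (ball (0 : EuclideanSpace ℝ (Fin n)) R \ ball 0 (R - s)) :=
      measurableSet_ball.diff measurableSet_ball
    constructor
    · exact (integrableOn_const (measure_ball_lt_top.ne)).indicator hmeas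
    · rw [setIntegral_indicator hmeas, inter_eq_self_of_subset_right diff_subset, setIntegral_const,
        smul_eq_mul]
  have hup : energy W (comp μ R) (ball (0 : EuclideanSpace ℝ (Fin n)) R) ≤
      (volume : Measure (EuclideanSpace ℝ (Fin n))).real
        (ball (0 : EuclideanSpace ℝ (Fin n)) R \ ball 0 (R - 1)) * C := by
    rw [← (key 1 C).2, energy]
    refine integral_mono_of_nonneg ?_ (key 1 C).1 ?_
    · exact Eventually.of_forall fun x => add_nonneg (by positivity) (hW0 _)
    · exact (ae_restrict_mem measurableSet_ball).mono fun x hx =>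
        hC n R x hR1 (by simpa using hx)
  have hlow : (volume : Measure (EuclideanSpace ℝ (Fin n))).real
        (ball (0 : EuclideanSpace ℝ (Fin n)) R \ ball 0 (R - d)) * m ≤
      energy W u (ball (0 : EuclideanSpace ℝ (Fin n)) R) := by
    rw [← (key d m).2, energy]
    refine setIntegral_mono_on (key d m).1 (energy_integrable hWc hR0 hu) measurableSet_ball ?_
    intro x hx
    by_cases hx2 : x ∈ ball (0 : EuclideanSpace ℝ (Fin n)) R \ ball 0 (R - d)
    · rw [indicator_of_mem hx2]
      have := hcon x (by simpa using hx2.2) (by simpa using hx2.1)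
      have : 0 ≤ (1:ℝ)/2 * ‖fderiv ℝ u x‖^2 := by positivity
      linarith
    · rw [indicator_of_notMem hx2]
      exact add_nonneg (by positivity) (hW0 _)
  rw [vol_shell hn (by norm_num) hR1] at hup
  rw [vol_shell hn (by linarith) hR] at hlow
  have hω : 0 < (volume : Measure (EuclideanSpace ℝ (Fin n))).real
      (ball (0 : EuclideanSpace ℝ (Fin n)) 1) :=
    ENNReal.toReal_pos (measure_ball_pos _ _ (by norm_num)).ne' measure_ball_lt_top.ne
  set ω := (volume : Measure (EuclideanSpace ℝ (Fin n))).real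
      (ball (0 : EuclideanSpace ℝ (Fin n)) 1)
  have hch := (hlow.trans h1).trans hup
  have h2 : (R ^ n - (R - d) ^ n) * m ≤ (R ^ n - (R - 1) ^ n) * C := by
    refine le_of_mul_le_mul_right ?_ hω
    linarith
  have h3 := mul_le_mul_of_nonneg_right (pow_upper (n := n) hR1) hC0.le
  have h4 := mul_le_mul_of_nonneg_right (pow_lower hn (by linarith : 0 ≤ d) hR) hm.le
  have h5 : 0 < R ^ (n - 1) := by positivity
  nlinarith

theorem stmt6 (n : ℕ) (hn : 0 < n) (W : ℝ → ℝ) (μ : ℝ) (hW : CondA' W μ)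
    (hW'' : 0 < deriv (deriv W) μ) :
    ∃ C₅ C₆ : ℝ, 0 < C₅ ∧ 0 < C₆ ∧
      ∀ (U : ℝ → ℝ), IsHetero W μ U →
      ∀ ε D D' R' : ℝ, ε ∈ Set.Ioo 0 μ → 0 ≤ D' → U D' = μ - ε → D' < D → D < R' →
      ∀ u : ℝ → EuclideanSpace ℝ (Fin n) → ℝ,
      -- `u_R`, `R ≥ R'`, are as in the lemma on minimizers over large balls:
      (∀ R ≥ R', ContDiffOn ℝ 2 (u R) (closedBall (0 : EuclideanSpace ℝ (Fin n)) R) ∧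
        (∀ v : EuclideanSpace ℝ (Fin n) → ℝ,
          ContDiffOn ℝ 1 v (closedBall (0 : EuclideanSpace ℝ (Fin n)) R) →
          (∀ x ∈ sphere (0 : EuclideanSpace ℝ (Fin n)) R, v x = 0) →
          energy W (u R) (ball (0 : EuclideanSpace ℝ (Fin n)) R) ≤
            energy W v (ball (0 : EuclideanSpace ℝ (Fin n)) R)) ∧
        (∀ x ∈ ball (0 : EuclideanSpace ℝ (Fin n)) R, lap (u R) x = deriv W (u R x)) ∧
        (∀ x ∈ sphere (0 : EuclideanSpace ℝ (Fin n)) R, u R x = 0) ∧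
        (∀ x ∈ closedBall (0 : EuclideanSpace ℝ (Fin n)) R, u R x = prof hn (u R) ‖x‖) ∧
        (∀ x ∈ ball (0 : EuclideanSpace ℝ (Fin n)) R, 0 < u R x ∧ u R x < μ) ∧
        (∀ x ∈ closedBall (0 : EuclideanSpace ℝ (Fin n)) (R - D), μ - ε ≤ u R x)) →
      -- exponential decay estimate
      ∀ R ≥ R', ∀ r ∈ Set.Icc (0:ℝ) (R - 2*D),
        μ - prof hn (u R) r ≤ C₅ * Real.exp (-C₆ * (R - r)) := by
  obtain ⟨hWC, hμ, hWμ, hWpos, hW0, -⟩ := hW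
  have hn' : (0:ℝ) < n := by exact_mod_cast hn
  have hWd : Differentiable ℝ W := hWC.differentiable (by norm_num)
  have hW1 : ContDiff ℝ 1 (deriv W) := by
    have : ContDiff ℝ (1 + 1) W := by simpa [one_add_one_eq_two] using hWC
    exact (contDiff_succ_iff_deriv.1 this).2.2
  have hW1d : Differentiable ℝ (deriv W) := hW1.differentiable (by norm_num)
  have hW2 : Continuous (deriv (deriv W)) := hW1.continuous_deriv (by norm_num)
  have hdμ : deriv W μ = 0 := by
    apply IsLocalMin.deriv_eq_zero
    exact Eventually.of_forall fun t => by rw [hWμ]; exact hW0 t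
  set c : ℝ := deriv (deriv W) μ / 2 with hc
  have hcpos : 0 < c := by positivity
  obtain ⟨ε, hε, hεμ, hεc⟩ : ∃ ε, 0 < ε ∧ ε < μ ∧
      ∀ t ∈ Icc (μ - ε) μ, c ≤ deriv (deriv W) t := by
    have hev : ∀ᶠ t in nhds μ, c < deriv (deriv W) t :=
      continuousAt_const.eventually_lt hW2.continuousAt (by rw [hc]; linarith)
    obtain ⟨δ, hδ, hδ'⟩ := Metric.eventually_nhds_iff.1 hev
    refine ⟨min (δ / 2) (μ / 2), by positivity, ?_, ?_⟩
    · exact (min_le_right _ _).trans_lt (by linarith)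
    · intro t ht
      refine (hδ' ?_).le
      have := min_le_left (δ / 2) (μ / 2)
      rw [Real.dist_eq, abs_lt]
      constructor <;> linarith [ht.1, ht.2]
  have hWc : ∀ t, μ - ε ≤ t → t ≤ μ → c * (μ - t) ≤ - deriv W t := by
    intro t h1 h2
    have := (convex_Icc (μ - ε) μ).mul_sub_le_image_sub_of_le_deriv
      hW1d.continuous.continuousOn hW1d.differentiableOn
      (fun x hx => hεc x (interior_subset hx)) t ⟨h1, h2⟩ μ ⟨by linarith, le_rfl⟩ h2
    rw [hdμ] at this
    linarith
  obtain ⟨m, hm, hmW⟩ : ∃ m, 0 < m ∧ ∀ t ∈ Icc 0 (μ - ε), m ≤ W t := by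
    obtain ⟨t0, ht0, htm⟩ := isCompact_Icc.exists_isMinOn (s := Icc (0:ℝ) (μ - ε))
      (nonempty_Icc.2 (by linarith)) hWd.continuous.continuousOn
    exact ⟨W t0, hWpos t0 ⟨ht0.1, by linarith [ht0.2]⟩, fun t ht => htm ht⟩
  obtain ⟨C, hC0, hC⟩ := comp_energy W hWd.continuous μ hμ hWμ hW0
  set d : ℝ := n * C / m + 1 with hd
  have hd1 : 1 ≤ d := by rw [hd]; have : 0 ≤ n * C / m := by positivity
                         linarith
  have hdm : n * C < m * d := by
    rw [hd]; field_simp; linarith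
  set k : ℝ := √c with hk
  have hkpos : 0 < k := Real.sqrt_pos.2 hcpos
  have hkc : k ^ 2 = c := Real.sq_sqrt hcpos.le
  refine ⟨(μ + 2 * ε * n) * Real.exp (k / n * d), k / n, by positivity, by positivity, ?_⟩
  intro U _ ε' D D' R' _ hD' _ hDD' hDR' u hu R hR r hr
  obtain ⟨huC, humin, hlap, -, hrad, hbd, -⟩ := hu R hR
  have hrR : r < R := by linarith [hr.2]
  have hR0 : 0 < R := hr.1.trans_lt hrR
  set x : EuclideanSpace ℝ (Fin n) := r • EuclideanSpace.single (⟨0, hn⟩ : Fin n) 1 with hx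
  have hxn : ‖x‖ = r := by simp [hx, norm_smul, abs_of_nonneg hr.1]
  have hpx : prof hn (u R) r = u R x := rfl
  rw [hpx, mul_assoc, ← Real.exp_add]
  have hxb : x ∈ ball (0 : EuclideanSpace ℝ (Fin n)) R := by simpa [hxn] using hrR
  rcases le_or_gt (R - r) d with hcase | hcase
  · have h1 : 1 ≤ Real.exp (k / n * d + -(k / n) * (R - r)) := by
      apply Real.one_le_exp
      have : 0 ≤ k / n * (d - (R - r)) := mul_nonneg (by positivity) (by linarith)
      linarith
    have h2 := (hbd x hxb).1
    have h3 : 0 < 2 * ε * n := by positivity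
    nlinarith
  · have huA : ∀ y ∈ ball (0 : EuclideanSpace ℝ (Fin n)) R, ContDiffAt ℝ 2 (u R) y := fun y hy =>
      huC.contDiffAt (closedBall_mem_nhds_of_mem hy)
    obtain ⟨z, hz1, hz2, hz3⟩ := exists_good hn hWd.continuous hW0 hm hC hC0 hd1 hdm
      (by linarith [hr.1] : d ≤ R) huC humin
    have hzb : z ∈ ball (0 : EuclideanSpace ℝ (Fin n)) R := by simpa using hz2
    rw [hrad z (ball_subset_closedBall hzb)] at hz3
    obtain ⟨s, hs, hsmin, hsW⟩ := smono hn hWd huA hlap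
      (fun y hy => hrad y (ball_subset_closedBall hy)) (norm_nonneg z) hz2
    have hWs : W (prof hn (u R) s) < m := by
      rcases hsW with h | h
      · rw [h]; exact hz3
      · exact h.trans_lt hz3
    have hsb := hbd (s • EuclideanSpace.single (⟨0, hn⟩ : Fin n) 1) (by
      simp [norm_smul, abs_of_nonneg hs.1]; linarith [hs.2])
    have hsε : μ - ε ≤ prof hn (u R) s := by
      by_contra! hlt
      have := hmW (prof hn (u R) s) ⟨hsb.1.le, hlt.le⟩
      linarith
    have hsub : ∀ y ∈ closedBall x (R - r - d), ‖y‖ ≤ R - d := by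
      intro y hy
      rw [mem_closedBall, dist_eq_norm] at hy
      have := norm_le_norm_add_norm_sub' y x
      linarith
    have hsubR : ∀ y ∈ closedBall x (R - r - d), y ∈ ball (0 : EuclideanSpace ℝ (Fin n)) R := by
      intro y hy
      have := hsub y hy
      rw [mem_ball_zero_iff]; linarith
    have hfin := barrier_s6 hn (u := u R) (W := W) (μ := μ) (ε := ε) (c := c) (k := k) (x := x)
      (ρ := R - r - d) (by linarith) hkpos hkc hε (fun y hy => huA y (hsubR y hy))
      (fun y hy => hlap y (hsubR y (ball_subset_closedBall hy)))
      (fun y hy => ⟨by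
        rw [hrad y (ball_subset_closedBall (hsubR y hy))]
        exact hsε.trans (hsmin _ ⟨norm_nonneg y, (hsub y hy).trans hz1⟩),
        (hbd y (hsubR y hy)).2.le⟩) hWc
    refine hfin.trans ?_
    rw [show -(k / n) * (R - r - d) = k / n * d + -(k / n) * (R - r) by ring]
    refine mul_le_mul_of_nonneg_right (by linarith) (Real.exp_pos _).le
end
end
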